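/- Let α ∈ (0,1), T ∈ (0,1], and let C : [0,1] → Matrix (Fin D) (Fin D) ℝ be α-Hölder continuous with δ|y|² ≤ yᵀC(t)C(t)ᵀy ≤ δ̄|y|² for all y ∈ ℝ^D and t ∈ [0,1], where 0 < δ ≤ δ̄. Let f : [0,T]×ℝ^D → ℝ be bounded continuous with finite parabolic α-Hölder norm |f|_α, and g : ℝ^D → ℝ of class C² with finite Hölder norm |g|_{2+α}. Then there exists a constant c depending only on δ, δ̄, α, D, and a unique function u of class C^{1,2} on [0,T]×ℝ^D with finite parabolic norm |u|_{2+α}, such that ∂_t u(t,y) + (1/2) tr( ∂_{yy}u(t,y) · C(t)C(t)ᵀ ) + f(t,y) = 0 for all (t,y) ∈ [0,T)×ℝ^D, u(T,y) = g(y) for all y, and moreover |u|_{1+α} ≤ c ( |g|_{1+α} + √T |f|_α ). -/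

import Mathlib

noncomputable section

open Real Set Matrix

/-- `Sig C t s = ∫_t^s C(u) C(u)ᵀ du` (entrywise Bochner integral). -/
noncomputable def Sig {D : ℕ} (C : ℝ → Matrix (Fin D) (Fin D) ℝ) (t s : ℝ) :
    Matrix (Fin D) (Fin D) ℝ :=
  fun i j => ∫ u in t..s, (C u * (C u)ᵀ) i j

/-- Uniform ellipticity: `δ |y|² ≤ yᵀ C(t)C(t)ᵀ y ≤ δ' |y|²` for all `t ∈ [0,1]`. -/
def Ellip (D : ℕ) (δ δ' : ℝ) (C : ℝ → Matrix (Fin D) (Fin D) ℝ) : Prop :=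
  ∀ t ∈ Set.Icc (0:ℝ) 1, ∀ y : Fin D → ℝ,
    δ * (∑ i, y i ^ 2) ≤ (∑ i, ∑ j, y i * (C t * (C t)ᵀ) i j * y j) ∧
    (∑ i, ∑ j, y i * (C t * (C t)ᵀ) i j * y j) ≤ δ' * (∑ i, y i ^ 2)

/-- Euclidean norm on `ℝ^D`. -/
noncomputable def en {D : ℕ} (x : Fin D → ℝ) : ℝ := Real.sqrt (∑ i, x i ^ 2)

/-- First partial derivative in the `d`-th coordinate direction. -/
noncomputable def pd {D : ℕ} (g : (Fin D → ℝ) → ℝ) (d : Fin D) (x : Fin D → ℝ) : ℝ :=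
  fderiv ℝ g x (Pi.single d 1)

/-- Second partial derivative. -/
noncomputable def pdd {D : ℕ} (g : (Fin D → ℝ) → ℝ) (d e : Fin D) (x : Fin D → ℝ) : ℝ :=
  fderiv ℝ (fun z => pd g e z) x (Pi.single d 1)

/-- Values `|g x|`. -/
def sup0Set {D : ℕ} (g : (Fin D → ℝ) → ℝ) : Set ℝ := {r | ∃ x, r = |g x|}

/-- `α`-Hölder quotients of `g : ℝ^D → ℝ`. -/
def hsemiSet {D : ℕ} (α : ℝ) (g : (Fin D → ℝ) → ℝ) : Set ℝ :=
  {r | ∃ x y, x ≠ y ∧ r = |g x - g y| / en (x - y) ^ α}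

/-- Values `|h t x|` for `t ∈ [0,T]`. -/
def psupSet {D : ℕ} (T : ℝ) (h : ℝ → (Fin D → ℝ) → ℝ) : Set ℝ :=
  {r | ∃ t x, t ∈ Set.Icc (0:ℝ) T ∧ r = |h t x|}

/-- Parabolic `α`-Hölder quotients of `h` on `[0,T] × ℝ^D`. -/
def psemiSet {D : ℕ} (T α : ℝ) (h : ℝ → (Fin D → ℝ) → ℝ) : Set ℝ :=
  {r | ∃ t x s y, t ∈ Set.Icc (0:ℝ) T ∧ s ∈ Set.Icc (0:ℝ) T ∧
    ((t, x) : ℝ × (Fin D → ℝ)) ≠ (s, y) ∧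
    r = |h t x - h s y| / (Real.sqrt |t - s| + en (x - y)) ^ α}

/-- The Hölder norm `|g|_{1+α}` of `g : ℝ^D → ℝ`. -/
noncomputable def gnorm1 {D : ℕ} (α : ℝ) (g : (Fin D → ℝ) → ℝ) : ℝ :=
  sSup (sup0Set g) + ∑ d, sSup (sup0Set (pd g d)) + ∑ d, sSup (hsemiSet α (pd g d))

/-- The parabolic Hölder norm `|f|_α` on `[0,T] × ℝ^D`. -/
noncomputable def fnorm0 {D : ℕ} (T α : ℝ) (f : ℝ → (Fin D → ℝ) → ℝ) : ℝ :=
  sSup (psupSet T f) + sSup (psemiSet T α f)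

/-- The parabolic Hölder norm `|u|_{1+α}` on `[0,T] × ℝ^D`. -/
noncomputable def unorm1 {D : ℕ} (T α : ℝ) (u : ℝ → (Fin D → ℝ) → ℝ) : ℝ :=
  sSup (psupSet T u) + ∑ d, sSup (psupSet T (fun t => pd (u t) d)) +
    ∑ d, sSup (psemiSet T α (fun t => pd (u t) d))

/-- `u` is a `C^{1,2}` solution, with finite parabolic `|·|_{2+α}` norm, of the heat
equation `∂ₜu + ½ tr(∂_{yy}u · C(t)C(t)ᵀ) + f = 0` on `[0,T) × ℝ^D`, `u(T,·) = g`. -/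
def HeatSol {D : ℕ} (T α : ℝ) (C : ℝ → Matrix (Fin D) (Fin D) ℝ)
    (f : ℝ → (Fin D → ℝ) → ℝ) (g : (Fin D → ℝ) → ℝ)
    (u : ℝ → (Fin D → ℝ) → ℝ) : Prop :=
  ContinuousOn (fun p : ℝ × (Fin D → ℝ) => u p.1 p.2) (Set.Icc 0 T ×ˢ Set.univ) ∧
  (∀ t ∈ Set.Icc (0:ℝ) T, ContDiff ℝ 2 (u t)) ∧
  (∀ x : Fin D → ℝ, ∀ t ∈ Set.Icc (0:ℝ) T,
    DifferentiableWithinAt ℝ (fun s => u s x) (Set.Icc 0 T) t) ∧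
  (∀ t ∈ Set.Ico (0:ℝ) T, ∀ x : Fin D → ℝ,
    derivWithin (fun s => u s x) (Set.Icc 0 T) t
      + (1/2) * (∑ i, ∑ j, pdd (u t) i j x * (C t * (C t)ᵀ) j i) + f t x = 0) ∧
  (∀ x, u T x = g x) ∧
  BddAbove (psupSet T u) ∧
  BddAbove (psupSet T (fun t x => derivWithin (fun s => u s x) (Set.Icc 0 T) t)) ∧
  BddAbove (psemiSet T α (fun t x => derivWithin (fun s => u s x) (Set.Icc 0 T) t)) ∧
  (∀ d, BddAbove (psupSet T (fun t => pd (u t) d))) ∧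
  (∀ d e, BddAbove (psupSet T (fun t => pdd (u t) d e))) ∧
  (∀ d e, BddAbove (psemiSet T α (fun t => pdd (u t) d e)))

section Calculus

open MeasureTheory Filter Topology Asymptotics

variable {D : ℕ}

lemma en_eq_norm (x : Fin D → ℝ) : en x = ‖WithLp.toLp 2 x‖ := by
  simp [en, EuclideanSpace.norm_eq]

lemma en_nonneg (x : Fin D → ℝ) : 0 ≤ en x := Real.sqrt_nonneg _

@[simp] lemma en_zero : en (0 : Fin D → ℝ) = 0 := by simp [en]

lemma abs_le_en (x : Fin D → ℝ) (i : Fin D) : |x i| ≤ en x := by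
  rw [en, ← Real.sqrt_sq_eq_abs]
  exact Real.sqrt_le_sqrt (Finset.single_le_sum (f := fun i => x i ^ 2)
    (fun j _ => sq_nonneg (x j)) (Finset.mem_univ i))

lemma norm_le_en (x : Fin D → ℝ) : ‖x‖ ≤ en x :=
  (pi_norm_le_iff_of_nonneg (en_nonneg x)).2 fun i => abs_le_en x i

lemma continuous_en : Continuous (en : (Fin D → ℝ) → ℝ) := by
  unfold en; fun_prop

lemma en_single (d : Fin D) (r : ℝ) : en (r • (Pi.single d 1 : Fin D → ℝ)) = |r| := by
  have : r • (Pi.single d 1 : Fin D → ℝ) = Pi.single d r := by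
    ext i; by_cases h : i = d
    · subst h; simp
    · simp [h]
  rw [this, en_eq_norm]
  simp

lemma eq_of_en_eq_zero {x : Fin D → ℝ} (h : en x = 0) : x = 0 := by
  have := norm_le_en x
  rw [h] at this
  exact norm_le_zero_iff.1 this

lemma en_pos_of_ne {x y : Fin D → ℝ} (h : x ≠ y) : 0 < en (x - y) :=
  lt_of_le_of_ne (en_nonneg _) fun h' => h (sub_eq_zero.1 (eq_of_en_eq_zero h'.symm))

/-- Bounded by `M` and `α`-Hölder continuous with constant `L`. -/
structure BH (α M L : ℝ) (F : (Fin D → ℝ) → ℝ) : Prop where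
  nonneg : 0 ≤ L
  bd : ∀ x, |F x| ≤ M
  hol : ∀ x y, |F x - F y| ≤ L * en (x - y) ^ α

lemma BH.M_nonneg {α M L : ℝ} {F : (Fin D → ℝ) → ℝ} (h : BH α M L F) : 0 ≤ M :=
  (abs_nonneg _).trans (h.bd 0)

lemma BH.mono {α M L M' L' : ℝ} {F : (Fin D → ℝ) → ℝ} (h : BH α M L F) (hM : M ≤ M')
    (hL : L ≤ L') : BH α M' L' F :=
  ⟨h.nonneg.trans hL, fun x => (h.bd x).trans hM, fun x y => (h.hol x y).trans
    (mul_le_mul_of_nonneg_right hL (Real.rpow_nonneg (en_nonneg _) _))⟩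

lemma continuous_of_hol {α L : ℝ} (hα : 0 < α) {F : (Fin D → ℝ) → ℝ}
    (h : ∀ x y, |F x - F y| ≤ L * en (x - y) ^ α) : Continuous F := by
  rw [continuous_iff_continuousAt]
  intro x
  rw [ContinuousAt, tendsto_iff_norm_sub_tendsto_zero]
  have h1 : Tendsto (fun y => L * en (y - x) ^ α) (𝓝 x) (𝓝 (L * en (x - x) ^ α)) := by
    have : Continuous fun y : Fin D → ℝ => L * en (y - x) ^ α := by
      have := continuous_en (D := D)
      exact continuous_const.mul ((this.comp (continuous_id.sub continuous_const)).rpow_const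
        fun _ => Or.inr hα.le)
    exact this.tendsto x
  rw [sub_self, en_zero, Real.zero_rpow hα.ne', mul_zero] at h1
  exact squeeze_zero (fun _ => norm_nonneg _) (fun y => h y x) h1

lemma BH.continuous {α M L : ℝ} (hα : 0 < α) {F : (Fin D → ℝ) → ℝ} (h : BH α M L F) :
    Continuous F := continuous_of_hol hα h.hol

/-- A bounded Lipschitz function is Hölder. -/
lemma hol_of_bd_lip {α M N : ℝ} (hα : 0 ≤ α) (hα1 : α ≤ 1) (hN : 0 ≤ N) {F : (Fin D → ℝ) → ℝ}
    (hM : ∀ x, |F x| ≤ M) (hl : ∀ x y, |F x - F y| ≤ N * en (x - y)) :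
    BH α M (2 * M + N) F := by
  have M0 : 0 ≤ M := (abs_nonneg _).trans (hM 0)
  refine ⟨by positivity, hM, fun x y => ?_⟩
  have e0 := en_nonneg (x - y)
  rcases le_total (en (x - y)) 1 with h | h
  · have h1 : en (x - y) ≤ en (x - y) ^ α := by
      rcases e0.eq_or_lt with h0 | h0
      · rw [← h0]; positivity
      · simpa using Real.rpow_le_rpow_of_exponent_ge h0 h hα1
    nlinarith [hl x y, Real.rpow_nonneg e0 α, mul_le_mul_of_nonneg_left h1 hN,
      mul_nonneg M0 (Real.rpow_nonneg e0 α)]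
  · have h1 : 1 ≤ en (x - y) ^ α := Real.one_le_rpow h hα
    have h2 : |F x - F y| ≤ 2 * M := (abs_sub _ _).trans (by linarith [hM x, hM y])
    nlinarith [mul_nonneg hN (Real.rpow_nonneg e0 α)]

lemma sum_single_smul (h : Fin D → ℝ) : ∑ d, h d • (Pi.single d 1 : Fin D → ℝ) = h := by
  ext i
  simp [Finset.sum_apply, Pi.single_apply]

lemma hasDerivAt_line {F : (Fin D → ℝ) → ℝ} {F' : Fin D → (Fin D → ℝ) → ℝ}
    (h : ∀ d x, HasDerivAt (fun r : ℝ => F (x + r • (Pi.single d 1 : Fin D → ℝ))) (F' d x) 0)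
    (d : Fin D) (x : Fin D → ℝ) (r : ℝ) :
    HasDerivAt (fun r : ℝ => F (x + r • (Pi.single d 1 : Fin D → ℝ)))
      (F' d (x + r • (Pi.single d 1 : Fin D → ℝ))) r := by
  have h1 := h d (x + r • (Pi.single d 1 : Fin D → ℝ))
  rw [← sub_self r] at h1
  have := h1.comp_sub_const r r
  refine this.congr_of_eventuallyEq (Eventually.of_forall fun s => ?_)
  simp only
  congr 1
  rw [add_assoc, ← add_smul]; congr 2; ring

/-- Continuous partial derivatives give a Fréchet derivative. -/
lemma hasFDerivAt_of_partials {F : (Fin D → ℝ) → ℝ} {F' : Fin D → (Fin D → ℝ) → ℝ}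
    (h : ∀ d x, HasDerivAt (fun r : ℝ => F (x + r • (Pi.single d 1 : Fin D → ℝ))) (F' d x) 0)
    (hc : ∀ d, Continuous (F' d)) (x : Fin D → ℝ) :
    HasFDerivAt F (∑ d, F' d x • (ContinuousLinearMap.proj d : (Fin D → ℝ) →L[ℝ] ℝ)) x := by
  have key : ∀ S : Finset (Fin D),
      (fun k : Fin D → ℝ => F (x + ∑ d ∈ S, k d • (Pi.single d 1 : Fin D → ℝ)) - F x
        - ∑ d ∈ S, F' d x * k d) =o[𝓝 0] (fun k => k) := by
    intro S
    induction S using Finset.induction_on with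
    | empty => simp
    | insert d S hd ih =>
      have h2 : (fun k : Fin D → ℝ =>
          F ((x + ∑ e ∈ S, k e • (Pi.single e 1 : Fin D → ℝ)) + k d • (Pi.single d 1 : Fin D → ℝ))
          - F (x + ∑ e ∈ S, k e • (Pi.single e 1 : Fin D → ℝ)) - F' d x * k d)
          =o[𝓝 0] (fun k => k) := by
        rw [isLittleO_iff]
        intro ε hε
        obtain ⟨η, hη, hη'⟩ := Metric.continuousAt_iff.1 (hc d).continuousAt ε hε
        filter_upwards [Metric.ball_mem_nhds (0 : Fin D → ℝ) hη] with k hk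
        rw [mem_ball_zero_iff] at hk
        set y := x + ∑ e ∈ S, k e • (Pi.single e 1 : Fin D → ℝ) with hy
        have hder : ∀ r ∈ uIcc 0 (k d), HasDerivWithinAt
            (fun r : ℝ => F (y + r • (Pi.single d 1 : Fin D → ℝ)) - F' d x * r)
            (F' d (y + r • (Pi.single d 1 : Fin D → ℝ)) - F' d x) (uIcc 0 (k d)) r := by
          intro r _
          have := (hasDerivAt_line h d y r).fun_sub ((hasDerivAt_id r).const_mul (F' d x))
          simpa using this.hasDerivWithinAt
        have hbd : ∀ r ∈ uIcc 0 (k d),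
            ‖F' d (y + r • (Pi.single d 1 : Fin D → ℝ)) - F' d x‖ ≤ ε := by
          intro r hr
          rw [← dist_eq_norm]
          refine (hη' ?_).le
          rw [dist_eq_norm]
          refine lt_of_le_of_lt ?_ hk
          refine (pi_norm_le_iff_of_nonneg (norm_nonneg k)).2 fun i => ?_
          have hki := norm_le_pi_norm k i
          have hkd := norm_le_pi_norm k d
          have hr' : |r| ≤ |k d| := by
            simpa using abs_sub_left_of_mem_uIcc hr
          simp only [hy, Pi.sub_apply, Pi.add_apply, Finset.sum_apply, Pi.smul_apply,
            Pi.single_apply, smul_eq_mul, mul_ite, mul_one, mul_zero, Finset.sum_ite_eq]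
          rw [Real.norm_eq_abs] at *
          by_cases hid : i = d
          · subst hid; simp [hd]; linarith
          · by_cases hiS : i ∈ S <;> simp [hid, hiS]
            simpa using hki
        have := (convex_uIcc 0 (k d)).norm_image_sub_le_of_norm_hasDerivWithin_le hder hbd
          left_mem_uIcc right_mem_uIcc
        simp only [zero_smul, add_zero, mul_zero, sub_zero] at this
        have hkd := norm_le_pi_norm k d
        calc _ = ‖F (y + k d • (Pi.single d 1 : Fin D → ℝ)) - F' d x * k d - F y‖ := by
              congr 1; ring
          _ ≤ ε * ‖k d‖ := this
          _ ≤ ε * ‖k‖ := by gcongr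
      refine (ih.add h2).congr_left fun k => ?_
      rw [Finset.sum_insert hd, Finset.sum_insert hd, add_comm (k d • _) (∑ e ∈ S, _), ← add_assoc]
      ring
  rw [hasFDerivAt_iff_isLittleO_nhds_zero]
  refine (key Finset.univ).congr_left fun k => ?_
  rw [sum_single_smul]
  simp

lemma pd_eq_of_partials {F : (Fin D → ℝ) → ℝ} {F' : Fin D → (Fin D → ℝ) → ℝ}
    (h : ∀ d x, HasDerivAt (fun r : ℝ => F (x + r • (Pi.single d 1 : Fin D → ℝ))) (F' d x) 0)
    (hc : ∀ d, Continuous (F' d)) : ContDiff ℝ 1 F ∧ ∀ d x, pd F d x = F' d x := by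
  have h1 := hasFDerivAt_of_partials h hc
  constructor
  · rw [contDiff_one_iff_fderiv]
    refine ⟨fun x => (h1 x).differentiableAt, ?_⟩
    have : fderiv ℝ F = fun x => ∑ d, F' d x •
        (ContinuousLinearMap.proj d : (Fin D → ℝ) →L[ℝ] ℝ) := funext fun x => (h1 x).fderiv
    rw [this]
    exact continuous_finsetSum _ fun d _ => (hc d).smul continuous_const
  · intro d x
    rw [pd, (h1 x).fderiv]
    simp [Pi.single_apply]

lemma fderiv_apply_eq_sum_pd {F : (Fin D → ℝ) → ℝ} (x z : Fin D → ℝ) :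
    fderiv ℝ F x z = ∑ d, z d * pd F d x := by
  conv_lhs => rw [← sum_single_smul z]
  simp [map_sum, pd]

lemma hasDerivAt_along {F : (Fin D → ℝ) → ℝ} (hF : ContDiff ℝ 1 F) (x z : Fin D → ℝ) (r : ℝ) :
    HasDerivAt (fun r : ℝ => F (x + r • z)) (∑ d, z d * pd F d (x + r • z)) r := by
  have h1 : HasFDerivAt F (fderiv ℝ F (x + r • z)) (x + r • z) :=
    (hF.differentiable one_ne_zero _).hasFDerivAt
  have h2 : HasDerivAt (fun r : ℝ => x + r • z) z r := by
    simpa using ((hasDerivAt_id r).smul_const z).const_add x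
  have := h1.comp_hasDerivAt r h2
  rwa [fderiv_apply_eq_sum_pd] at this

lemma hasDerivAt_along_single {F : (Fin D → ℝ) → ℝ} (hF : ContDiff ℝ 1 F) (d : Fin D)
    (x : Fin D → ℝ) (r : ℝ) :
    HasDerivAt (fun r : ℝ => F (x + r • (Pi.single d 1 : Fin D → ℝ)))
      (pd F d (x + r • (Pi.single d 1 : Fin D → ℝ))) r := by
  simpa [Pi.single_apply] using hasDerivAt_along hF x (Pi.single d 1) r

lemma continuous_pd {F : (Fin D → ℝ) → ℝ} (hF : ContDiff ℝ 1 F) (d : Fin D) :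
    Continuous (pd F d) :=
  (hF.continuous_fderiv one_ne_zero).clm_apply continuous_const

lemma contDiff_two_of_pd {F : (Fin D → ℝ) → ℝ} (hF : ContDiff ℝ 1 F)
    (h : ∀ d, ContDiff ℝ 1 (pd F d)) : ContDiff ℝ 2 F := by
  have h2 : (2 : WithTop ℕ∞) = 1 + 1 := by norm_num
  rw [h2, contDiff_succ_iff_fderiv]
  refine ⟨hF.differentiable one_ne_zero, by simp, ?_⟩
  have : fderiv ℝ F = fun x => ∑ d, pd F d x •
      (ContinuousLinearMap.proj d : (Fin D → ℝ) →L[ℝ] ℝ) := by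
    ext1 x; ext1 z
    rw [fderiv_apply_eq_sum_pd]
    simp [mul_comm]
  rw [this]
  exact ContDiff.sum fun d _ => (h d).smul contDiff_const

lemma contDiff_pd {F : (Fin D → ℝ) → ℝ} (hF : ContDiff ℝ 2 F) (d : Fin D) :
    ContDiff ℝ 1 (pd F d) := by
  have h2 : (2 : WithTop ℕ∞) = 1 + 1 := by norm_num
  rw [h2, contDiff_succ_iff_fderiv] at hF
  exact hF.2.2.clm_apply contDiff_const

/-- Bounded partial derivatives give a Lipschitz bound. -/
lemma lip_of_pd_bd {F : (Fin D → ℝ) → ℝ} (hF : ContDiff ℝ 1 F) {B : ℝ}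
    (hB : ∀ d x, |pd F d x| ≤ B) (x y : Fin D → ℝ) : |F x - F y| ≤ D * B * en (x - y) := by
  have h1 : ∀ r ∈ Icc (0 : ℝ) 1, HasDerivWithinAt (fun r : ℝ => F (y + r • (x - y)))
      (∑ d, (x - y) d * pd F d (y + r • (x - y))) (Icc 0 1) r := fun r _ =>
    (hasDerivAt_along hF y (x - y) r).hasDerivWithinAt
  have h2 : ∀ r ∈ Icc (0 : ℝ) 1,
      ‖∑ d, (x - y) d * pd F d (y + r • (x - y))‖ ≤ D * B * en (x - y) := by
    intro r _
    refine (norm_sum_le _ _).trans ?_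
    have : ∀ d ∈ (Finset.univ : Finset (Fin D)),
        ‖(x - y) d * pd F d (y + r • (x - y))‖ ≤ en (x - y) * B := fun d _ => by
      rw [norm_mul]
      exact mul_le_mul (abs_le_en _ _) (hB _ _) (norm_nonneg _) (en_nonneg _)
    refine (Finset.sum_le_sum this).trans ?_
    simp only [Finset.sum_const, Finset.card_univ, Fintype.card_fin, nsmul_eq_mul]
    exact le_of_eq (by ring)
  have := (convex_Icc (0:ℝ) 1).norm_image_sub_le_of_norm_hasDerivWithin_le h1 h2
    (left_mem_Icc.2 zero_le_one) (right_mem_Icc.2 zero_le_one)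
  simpa using this

/-- Differentiation under the integral sign for a family of `C¹` functions. -/
lemma integral_C1 {Ω : Type*} [MeasurableSpace Ω] {m : Measure Ω} {F : Ω → (Fin D → ℝ) → ℝ}
    {B : Ω → ℝ} (hB : Integrable B m) (h_int : ∀ x, Integrable (fun ω => F ω x) m)
    (hC1 : ∀ᵐ ω ∂m, ContDiff ℝ 1 (F ω)) (hbd : ∀ᵐ ω ∂m, ∀ d x, |pd (F ω) d x| ≤ B ω) :
    ContDiff ℝ 1 (fun x => ∫ ω, F ω x ∂m) ∧
      (∀ d x, pd (fun x => ∫ ω, F ω x ∂m) d x = ∫ ω, pd (F ω) d x ∂m) ∧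
      ∀ d x, Integrable (fun ω => pd (F ω) d x) m := by
  have hmeas : ∀ d x, AEStronglyMeasurable (fun ω => pd (F ω) d x) m := by
    intro d x
    refine aestronglyMeasurable_of_tendsto_ae atTop
      (f := fun (n : ℕ) ω => ((n : ℝ) + 1) *
        (F ω (x + (1 / ((n : ℝ) + 1)) • (Pi.single d 1 : Fin D → ℝ)) - F ω x))
      (fun n => ((h_int _).sub (h_int x)).aestronglyMeasurable.const_mul _) ?_
    filter_upwards [hC1] with ω hω
    have h1 := (hasDerivAt_along_single hω d x 0).tendsto_slope
    simp only [zero_smul, add_zero] at h1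
    have h2 : Tendsto (fun n : ℕ => 1 / ((n : ℝ) + 1)) atTop (𝓝[≠] 0) := by
      refine tendsto_nhdsWithin_iff.2 ⟨tendsto_one_div_add_atTop_nhds_zero_nat, ?_⟩
      exact Eventually.of_forall fun n => by
        have : (0 : ℝ) < 1 / ((n : ℝ) + 1) := by positivity
        exact this.ne'
    refine (h1.comp h2).congr fun n => ?_
    simp [slope_def_field, div_eq_mul_inv, mul_comm]
  have hi : ∀ d x, Integrable (fun ω => pd (F ω) d x) m := fun d x =>
    hB.mono' (hmeas d x) (hbd.mono fun ω h => h d x)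
  have := pd_eq_of_partials (F := fun x => ∫ ω, F ω x ∂m) (F' := fun d x => ∫ ω, pd (F ω) d x ∂m)
    ?_ ?_
  · exact ⟨this.1, this.2, hi⟩
  · intro d x
    have := (hasDerivAt_integral_of_dominated_loc_of_deriv_le (μ := m) (x₀ := (0:ℝ))
      (F := fun r ω => F ω (x + r • (Pi.single d 1 : Fin D → ℝ)))
      (F' := fun r ω => pd (F ω) d (x + r • (Pi.single d 1 : Fin D → ℝ))) (bound := B)
      (s := univ) univ_mem
      (Eventually.of_forall fun r => (h_int _).aestronglyMeasurable) (h_int _) (hmeas _ _)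
      (hbd.mono fun ω h r _ => h _ _) hB
      (hC1.mono fun ω h r _ => hasDerivAt_along_single h d x r)).2
    simpa using this
  · intro d
    exact continuous_of_dominated (fun x => hmeas d x) (fun x => hbd.mono fun ω h => h d x) hB
      (hC1.mono fun ω h => continuous_pd h d)

end Calculus

section Smoothing

open MeasureTheory ProbabilityTheory Filter Topology
open scoped NNReal

lemma rpow_le_scaled {v : ℝ} (hv : 0 < v) {p : ℝ} (hp : 0 ≤ p) (hp2 : p ≤ 2) (z : ℝ) :
    |z| ^ p ≤ v ^ (p / 2) * (1 + z ^ 2 / v) := by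
  have hs : 0 < √v := Real.sqrt_pos.2 hv
  have h1 : ∀ a : ℝ, 0 ≤ a → a ^ p ≤ 1 + a ^ 2 := by
    intro a ha
    rcases le_total a 1 with h | h
    · have := Real.rpow_le_one ha h hp
      nlinarith [sq_nonneg a]
    · have := Real.rpow_le_rpow_of_exponent_le h hp2
      rw [Real.rpow_two] at this
      linarith
  have h2 := h1 (|z| / √v) (by positivity)
  rw [Real.div_rpow (abs_nonneg _) hs.le, div_pow, sq_abs, Real.sq_sqrt hv.le,
    Real.sqrt_eq_rpow, ← Real.rpow_mul hv.le, one_div_mul_eq_div,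
    div_le_iff₀ (by positivity)] at h2
  linarith

lemma gaussian_abs_moment {v : ℝ≥0} (hv : v ≠ 0) {p : ℝ} (hp : 0 ≤ p) (hp2 : p ≤ 2) :
    Integrable (fun z : ℝ => |z| ^ p) (gaussianReal 0 v) ∧
      ∫ z, |z| ^ p ∂gaussianReal 0 v ≤ 2 * (v : ℝ) ^ (p / 2) := by
  have hv' : (0 : ℝ) < v := by positivity
  have hsq : Integrable (fun z : ℝ => z ^ 2) (gaussianReal 0 v) :=
    (memLp_id_gaussianReal (μ := 0) (v := v) 2).integrable_sq
  have hi : Integrable (fun z : ℝ => (v : ℝ) ^ (p / 2) * (1 + z ^ 2 / v)) (gaussianReal 0 v) :=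
    ((integrable_const _).add (hsq.div_const _)).const_mul _
  have h_int : Integrable (fun z : ℝ => |z| ^ p) (gaussianReal 0 v) := by
    refine hi.mono' (by fun_prop) (Eventually.of_forall fun z => ?_)
    rw [Real.norm_of_nonneg (by positivity)]
    exact rpow_le_scaled hv' hp hp2 z
  refine ⟨h_int, (integral_mono h_int hi fun z => rpow_le_scaled hv' hp hp2 z).trans ?_⟩
  have hvar : ∫ z, z ^ 2 ∂gaussianReal 0 v = v := by
    have h := variance_fun_id_gaussianReal (μ := 0) (v := v)
    rw [variance_of_integral_eq_zero (by fun_prop) (by simp)] at h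
    exact h
  rw [integral_const_mul, integral_add (integrable_const _) (hsq.div_const _), integral_div, hvar]
  simp only [integral_const, probReal_univ, smul_eq_mul, mul_one]
  rw [div_self hv'.ne']
  exact le_of_eq (by ring)

lemma hasDerivAt_gaussian_average {v : ℝ≥0} (hv : v ≠ 0) {h : ℝ → ℝ} (hc : Continuous h) {M : ℝ}
    (hM : ∀ z, |h z| ≤ M) :
    HasDerivAt (fun r : ℝ => ∫ z, h (r + z) ∂gaussianReal 0 v)
      ((v : ℝ)⁻¹ * ∫ z, h z * z ∂gaussianReal 0 v) 0 := by
  have hv' : (0 : ℝ) < v := by positivity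
  have M0 : 0 ≤ M := (abs_nonneg _).trans (hM 0)
  have e1 : ∀ r : ℝ, ∫ z, h (r + z) ∂gaussianReal 0 v = ∫ y, gaussianPDFReal r v y * h y := by
    intro r
    have := gaussianReal_map_const_add (μ := 0) (v := v) r
    rw [zero_add] at this
    rw [← integral_map (μ := gaussianReal 0 v) (φ := fun z => r + z) (f := h) (by fun_prop)
      hc.aestronglyMeasurable, this, integral_gaussianReal_eq_integral_smul hv]
    rfl
  simp_rw [e1]
  have e2 : (v : ℝ)⁻¹ * ∫ z, h z * z ∂gaussianReal 0 v
      = ∫ y, gaussianPDFReal 0 v y * ((y - 0) / v) * h y := by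
    rw [integral_gaussianReal_eq_integral_smul hv, ← integral_const_mul]
    congr 1; ext y; simp only [smul_eq_mul]; ring
  rw [e2]
  set K := (√(2 * π * v))⁻¹ with hK
  have K0 : 0 ≤ K := by positivity
  have hb : (0:ℝ) < 1 / (4 * v) := by positivity
  have hbi : Integrable (fun y : ℝ => K * rexp (1 / (2 * v)) * M / v *
      (|y * rexp (-(1 / (4 * v)) * y ^ 2)| + rexp (-(1 / (4 * v)) * y ^ 2))) :=
    ((integrable_mul_exp_neg_mul_sq hb).abs.add (integrable_exp_neg_mul_sq hb)).const_mul _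
  have hpm : ∀ r : ℝ, Measurable (gaussianPDFReal r v) := fun r => measurable_gaussianPDFReal r v
  refine (hasDerivAt_integral_of_dominated_loc_of_deriv_le (μ := volume) (x₀ := (0:ℝ))
      (F := fun r y => gaussianPDFReal r v y * h y)
      (F' := fun r y => gaussianPDFReal r v y * ((y - r) / v) * h y)
      (s := Metric.ball 0 1) (Metric.ball_mem_nhds _ one_pos)
      (Eventually.of_forall fun r => ((hpm r).mul hc.measurable).aestronglyMeasurable)
      ((integrable_gaussianPDFReal 0 v).mul_bdd (c := M) hc.aestronglyMeasurable
        (Eventually.of_forall hM))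
      ((((hpm 0).mul (by fun_prop)).mul hc.measurable).aestronglyMeasurable)
      (Eventually.of_forall fun y r hr => ?_) hbi
      (Eventually.of_forall fun y r _ => ?_)).2
  · rw [Metric.mem_ball, dist_zero_right, Real.norm_eq_abs, abs_lt] at hr
    have h1 : rexp (-(y - r) ^ 2 / (2 * v))
        ≤ rexp (1 / (2 * v)) * rexp (-(1 / (4 * v)) * y ^ 2) := by
      rw [← Real.exp_add, Real.exp_le_exp]
      have : -(y - r) ^ 2 ≤ 1 - y ^ 2 / 2 := by nlinarith [sq_nonneg (y - 2 * r)]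
      calc -(y - r) ^ 2 / (2 * v) ≤ (1 - y ^ 2 / 2) / (2 * v) := by gcongr
        _ = _ := by field_simp; ring
    have h2 : |y - r| ≤ |y| + 1 :=
      (abs_sub _ _).trans (by gcongr; exact abs_le.2 ⟨hr.1.le, hr.2.le⟩)
    rw [gaussianPDFReal, norm_mul, norm_mul, norm_mul, norm_div, ← hK, Real.norm_of_nonneg K0,
      Real.norm_of_nonneg (Real.exp_pos _).le, Real.norm_of_nonneg hv'.le, abs_mul,
      abs_of_pos (Real.exp_pos _)]
    calc K * rexp (-(y - r) ^ 2 / (2 * v)) * (‖y - r‖ / v) * ‖h y‖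
        ≤ K * (rexp (1 / (2 * v)) * rexp (-(1 / (4 * v)) * y ^ 2)) * ((|y| + 1) / v) * M := by
          gcongr
          · exact h2
          · exact hM y
      _ = _ := by ring
  · have h1 : HasDerivAt (fun r : ℝ => -(y - r) ^ 2 / (2 * v)) ((y - r) / v) r := by
      have := ((((hasDerivAt_id r).const_sub y).pow 2).neg).div_const (2 * (v:ℝ))
      convert! this using 1
      simp only [id_eq, Nat.cast_ofNat]
      field_simp
      ring
    have := ((h1.exp.const_mul K).mul_const (h y))
    convert! this using 1
    rw [gaussianPDFReal]; ring

variable {D : ℕ}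

/-- The average of `F` over translations distributed according to `μ`. -/
def avg (μ : Measure (Fin D → ℝ)) (F : (Fin D → ℝ) → ℝ) (x : Fin D → ℝ) : ℝ :=
  ∫ z, F (x + z) ∂μ

lemma integrable_translate {μ : Measure (Fin D → ℝ)} [IsProbabilityMeasure μ]
    {F : (Fin D → ℝ) → ℝ} (hc : Continuous F) {M : ℝ} (hM : ∀ x, |F x| ≤ M) (x : Fin D → ℝ) :
    Integrable (fun z => F (x + z)) μ :=
  (integrable_const M).mono' (hc.comp (by fun_prop)).aestronglyMeasurable
    (Eventually.of_forall fun _ => hM _)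

lemma abs_avg_le {μ : Measure (Fin D → ℝ)} [IsProbabilityMeasure μ]
    {F : (Fin D → ℝ) → ℝ} {M : ℝ} (hM : ∀ x, |F x| ≤ M) (x : Fin D → ℝ) :
    |avg μ F x| ≤ M := by
  have := norm_integral_le_of_norm_le_const (μ := μ) (f := fun z => F (x + z)) (C := M)
    (Eventually.of_forall fun z => hM _)
  simpa [avg] using this

lemma abs_avg_sub_avg_le {μ : Measure (Fin D → ℝ)} [IsProbabilityMeasure μ]
    {F G : (Fin D → ℝ) → ℝ} {x y : Fin D → ℝ} {M : ℝ}
    (hF : Integrable (fun z => F (x + z)) μ) (hG : Integrable (fun z => G (y + z)) μ)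
    (hM : ∀ z, |F (x + z) - G (y + z)| ≤ M) : |avg μ F x - avg μ G y| ≤ M := by
  rw [avg, avg, ← integral_sub hF hG]
  have := norm_integral_le_of_norm_le_const (μ := μ) (f := fun z => F (x + z) - G (y + z)) (C := M)
    (Eventually.of_forall fun z => hM z)
  simpa using this

lemma BH.avg {α M L : ℝ} (hα : 0 < α) {F : (Fin D → ℝ) → ℝ} (h : BH α M L F)
    (μ : Measure (Fin D → ℝ)) [IsProbabilityMeasure μ] : BH α M L (avg μ F) := by
  refine ⟨h.nonneg, abs_avg_le h.bd, fun x y => ?_⟩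
  refine abs_avg_sub_avg_le (integrable_translate (h.continuous hα) h.bd x)
    (integrable_translate (h.continuous hα) h.bd y) fun z => ?_
  simpa using h.hol (x + z) (y + z)

lemma avg_conv {F : (Fin D → ℝ) → ℝ} (hc : Continuous F) {M : ℝ} (hM : ∀ x, |F x| ≤ M)
    (μ ν : Measure (Fin D → ℝ)) [IsProbabilityMeasure μ] [IsProbabilityMeasure ν] :
    avg (Measure.conv μ ν) F = avg μ (avg ν F) := by
  ext x
  rw [avg, integral_conv (integrable_translate hc hM x)]
  simp only [avg, add_assoc]

lemma avg_C1 {F : (Fin D → ℝ) → ℝ} (hF : ContDiff ℝ 1 F) {M N : ℝ} (hM : ∀ x, |F x| ≤ M)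
    (hN : ∀ d x, |pd F d x| ≤ N) (μ : Measure (Fin D → ℝ)) [IsProbabilityMeasure μ] :
    ContDiff ℝ 1 (avg μ F) ∧ ∀ d, pd (avg μ F) d = avg μ (pd F d) := by
  have hpd : ∀ z d x, pd (fun x => F (x + z)) d x = pd F d (x + z) := fun z d x => by
    simp only [pd, fderiv_comp_add_right]
  have := integral_C1 (m := μ) (F := fun z x => F (x + z)) (B := fun _ => N) (integrable_const _)
    (fun x => integrable_translate hF.continuous hM x)
    (Eventually.of_forall fun z => hF.comp (contDiff_id.add contDiff_const))
    (Eventually.of_forall fun z d x => by rw [hpd]; exact hN _ _)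
  refine ⟨this.1, fun d => funext fun x => ?_⟩
  have h2 := this.2.1 d x
  simp only [hpd] at h2
  exact h2

/-- `μ` has a one-dimensional Gaussian component of variance `τ` in each coordinate direction. -/
def HasGaussianComponents (τ : ℝ≥0) (μ : Measure (Fin D → ℝ)) : Prop :=
  ∀ d : Fin D, ∃ ν : Measure (Fin D → ℝ), IsProbabilityMeasure ν ∧
    μ = Measure.conv ((gaussianReal 0 τ).map fun z => z • (Pi.single d 1 : Fin D → ℝ)) ν

lemma avg_gaussian_component {F : (Fin D → ℝ) → ℝ} (hc : Continuous F) {M : ℝ}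
    (hM : ∀ x, |F x| ≤ M) (τ : ℝ≥0) (ν : Measure (Fin D → ℝ)) [IsProbabilityMeasure ν]
    (hcν : Continuous (avg ν F)) (d : Fin D) (x : Fin D → ℝ) :
    avg (Measure.conv ((gaussianReal 0 τ).map fun z => z • (Pi.single d 1 : Fin D → ℝ)) ν) F x
      = ∫ z, avg ν F (x + z • (Pi.single d 1 : Fin D → ℝ)) ∂gaussianReal 0 τ := by
  have hm : Measurable fun z : ℝ => z • (Pi.single d 1 : Fin D → ℝ) := by fun_prop
  have := Measure.isProbabilityMeasure_map (μ := gaussianReal 0 τ) hm.aemeasurable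
  rw [avg_conv hc hM]
  conv_lhs => rw [avg]
  exact integral_map (f := fun z => avg ν F (x + z)) hm.aemeasurable
    (hcν.comp (by fun_prop)).aestronglyMeasurable

/-- Smoothing by a measure with Gaussian components. -/
lemma smoothing {α M L : ℝ} (hα : 0 < α) (hα1 : α ≤ 1) {τ : ℝ≥0} (hτ : τ ≠ 0)
    {μ : Measure (Fin D → ℝ)} [IsProbabilityMeasure μ] (hμ : HasGaussianComponents τ μ)
    {F : (Fin D → ℝ) → ℝ} (hF : BH α M L F) :
    ContDiff ℝ 1 (avg μ F) ∧ ∀ d,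
      BH α (2 * (τ : ℝ) ^ (-1 / 2 : ℝ) * M) (2 * (τ : ℝ) ^ (-1 / 2 : ℝ) * L) (pd (avg μ F) d) ∧
      ∀ x, |pd (avg μ F) d x| ≤ 2 * (τ : ℝ) ^ ((α - 1) / 2) * L := by
  have hτ' : (0 : ℝ) < τ := by positivity
  choose ν hν hμν using hμ
  set Q : Fin D → (Fin D → ℝ) → ℝ := fun d x => (τ : ℝ)⁻¹ *
    ∫ z, avg (ν d) F (x + z • (Pi.single d 1 : Fin D → ℝ)) * z ∂gaussianReal 0 τ with hQ
  have hG : ∀ d, BH α M L (avg (ν d) F) := fun d => hF.avg hα (ν d)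
  have hGc : ∀ d, Continuous (avg (ν d) F) := fun d => (hG d).continuous hα
  have hz : Integrable (fun z : ℝ => z) (gaussianReal 0 τ) :=
    (memLp_id_gaussianReal (μ := 0) (v := τ) 1).integrable (by simp)
  have h_int : ∀ d x, Integrable (fun z => avg (ν d) F (x + z • (Pi.single d 1 : Fin D → ℝ)) * z)
      (gaussianReal 0 τ) := fun d x =>
    hz.bdd_mul (c := M) ((hGc d).comp (by fun_prop)).aestronglyMeasurable
      (Eventually.of_forall fun _ => (hG d).bd _)
  have m1 := gaussian_abs_moment hτ (p := 1) zero_le_one one_le_two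
  simp only [Real.rpow_one] at m1
  have ma := gaussian_abs_moment hτ (p := 1 + α) (by linarith) (by linarith)
  have t1 : (τ : ℝ)⁻¹ * (τ : ℝ) ^ (1 / 2 : ℝ) = (τ : ℝ) ^ (-1 / 2 : ℝ) := by
    rw [← Real.rpow_neg_one, ← Real.rpow_add hτ']; norm_num
  have ta : (τ : ℝ)⁻¹ * (τ : ℝ) ^ ((1 + α) / 2 : ℝ) = (τ : ℝ) ^ ((α - 1) / 2 : ℝ) := by
    rw [← Real.rpow_neg_one, ← Real.rpow_add hτ']; ring_nf
  have bound1 : ∀ (k : ℝ → ℝ) (N : ℝ), (∀ z, |k z| ≤ N) →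
      |(τ : ℝ)⁻¹ * ∫ z, k z * z ∂gaussianReal 0 τ| ≤ 2 * (τ : ℝ) ^ (-1 / 2 : ℝ) * N := by
    intro k N hk
    have N0 : 0 ≤ N := (abs_nonneg _).trans (hk 0)
    have := norm_integral_le_of_norm_le (μ := gaussianReal 0 τ) (f := fun z => k z * z)
      (m1.1.const_mul N) (Eventually.of_forall fun z => by
        rw [norm_mul]; exact mul_le_mul_of_nonneg_right (hk z) (abs_nonneg _))
    rw [integral_const_mul] at this
    rw [abs_mul, abs_of_pos (inv_pos.2 hτ')]
    calc _ ≤ (τ : ℝ)⁻¹ * (N * (2 * (τ : ℝ) ^ (1 / 2 : ℝ))) :=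
          mul_le_mul_of_nonneg_left (this.trans (mul_le_mul_of_nonneg_left m1.2 N0))
            (inv_pos.2 hτ').le
      _ = 2 * ((τ : ℝ)⁻¹ * (τ : ℝ) ^ (1 / 2 : ℝ)) * N := by ring
      _ = _ := by rw [t1]
  have hQhol : ∀ d x y, |Q d x - Q d y| ≤ 2 * (τ : ℝ) ^ (-1 / 2 : ℝ) * L * en (x - y) ^ α := by
    intro d x y
    have e : Q d x - Q d y = (τ : ℝ)⁻¹ * ∫ z, (avg (ν d) F (x + z • (Pi.single d 1 : Fin D → ℝ)) -
        avg (ν d) F (y + z • (Pi.single d 1 : Fin D → ℝ))) * z ∂gaussianReal 0 τ := by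
      simp only [hQ, sub_mul]
      rw [integral_sub (h_int d x) (h_int d y)]; ring
    rw [e, mul_assoc _ L]
    exact bound1 _ _ fun z => by
      have h1 := (hG d).hol (x + z • (Pi.single d 1 : Fin D → ℝ))
        (y + z • (Pi.single d 1 : Fin D → ℝ))
      have h2 : x + z • (Pi.single d 1 : Fin D → ℝ) - (y + z • (Pi.single d 1 : Fin D → ℝ))
        = x - y := by abel
      rwa [h2] at h1
  have hder := pd_eq_of_partials (F := avg μ F) (F' := Q) ?_
    fun d => continuous_of_hol hα (hQhol d)
  · refine ⟨hder.1, fun d => ?_⟩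
    have hpd : pd (avg μ F) d = Q d := funext (hder.2 d)
    rw [hpd]
    refine ⟨⟨by have := hF.nonneg; positivity, fun x => bound1 _ _ fun z => (hG d).bd _,
      hQhol d⟩, fun x => ?_⟩
    have e : Q d x = (τ : ℝ)⁻¹ * ∫ z, (avg (ν d) F (x + z • (Pi.single d 1 : Fin D → ℝ)) -
        avg (ν d) F x) * z ∂gaussianReal 0 τ := by
      simp only [hQ, sub_mul]
      rw [integral_sub (h_int d x) (hz.const_mul _), integral_const_mul]
      simp
    have := norm_integral_le_of_norm_le (μ := gaussianReal 0 τ)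
      (f := fun z => (avg (ν d) F (x + z • (Pi.single d 1 : Fin D → ℝ)) - avg (ν d) F x) * z)
      (ma.1.const_mul L) (Eventually.of_forall fun z => by
        have h1 := (hG d).hol (x + z • (Pi.single d 1 : Fin D → ℝ)) x
        rw [add_sub_cancel_left, en_single] at h1
        rw [norm_mul, add_comm 1 α]
        rcases eq_or_ne z 0 with rfl | hz0
        · have := hF.nonneg
          simp; positivity
        · rw [Real.rpow_add (abs_pos.2 hz0), Real.rpow_one, ← mul_assoc]
          exact mul_le_mul_of_nonneg_right h1 (abs_nonneg _))
    rw [integral_const_mul] at this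
    rw [e, abs_mul, abs_of_pos (inv_pos.2 hτ')]
    calc _ ≤ (τ : ℝ)⁻¹ * (L * (2 * (τ : ℝ) ^ ((1 + α) / 2 : ℝ))) :=
          mul_le_mul_of_nonneg_left (this.trans (mul_le_mul_of_nonneg_left ma.2 hF.nonneg))
            (inv_pos.2 hτ').le
      _ = 2 * ((τ : ℝ)⁻¹ * (τ : ℝ) ^ ((1 + α) / 2 : ℝ)) * L := by ring
      _ = _ := by rw [ta]
  · intro d x
    have h1 := hasDerivAt_gaussian_average hτ
      (h := fun z => avg (ν d) F (x + z • (Pi.single d 1 : Fin D → ℝ)))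
      ((hGc d).comp (by fun_prop)) (M := M) (fun z => (hG d).bd _)
    refine h1.congr_of_eventuallyEq (Eventually.of_forall fun r => ?_)
    simp only
    conv_lhs => rw [hμν d]
    rw [avg_gaussian_component (hF.continuous hα) hF.bd τ (ν d) (hGc d)]
    simp only [add_smul, add_assoc]

end Smoothing

section GaussianMeasures

open MeasureTheory ProbabilityTheory Filter Topology WithLp
open scoped NNReal RealInnerProductSpace MatrixOrder

variable {D : ℕ}

/-- The centred Gaussian measure on `ℝ^D` with covariance matrix `S`. -/
def centredGaussian (S : Matrix (Fin D) (Fin D) ℝ) : Measure (Fin D → ℝ) :=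
  (multivariateGaussian (0 : EuclideanSpace ℝ (Fin D)) S).map ofLp

instance (S : Matrix (Fin D) (Fin D) ℝ) : IsProbabilityMeasure (centredGaussian S) :=
  Measure.isProbabilityMeasure_map (by fun_prop)

lemma integral_centredGaussian (S : Matrix (Fin D) (Fin D) ℝ) {F : (Fin D → ℝ) → ℝ}
    (hF : Continuous F) : ∫ z, F z ∂centredGaussian S =
      ∫ z, F (ofLp z) ∂multivariateGaussian (0 : EuclideanSpace ℝ (Fin D)) S :=
  integral_map (by fun_prop) hF.aestronglyMeasurable

lemma integrable_centredGaussian_iff (S : Matrix (Fin D) (Fin D) ℝ) {F : (Fin D → ℝ) → ℝ}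
    (hF : Continuous F) : Integrable F (centredGaussian S) ↔
      Integrable (fun z => F (ofLp z)) (multivariateGaussian (0 : EuclideanSpace ℝ (Fin D)) S) :=
  integrable_map_measure hF.aestronglyMeasurable (by fun_prop)

lemma memLp_eval_multivariateGaussian (S : Matrix (Fin D) (Fin D) ℝ) (i : Fin D) :
    MemLp (fun z => z i) 2 (multivariateGaussian (0 : EuclideanSpace ℝ (Fin D)) S) := by
  have := (IsGaussian.memLp_two_id (μ := multivariateGaussian (0 : EuclideanSpace ℝ (Fin D)) S))
  exact (EuclideanSpace.proj (𝕜 := ℝ) i).comp_memLp' this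

lemma integrable_eval_centredGaussian (S : Matrix (Fin D) (Fin D) ℝ) (i : Fin D) :
    Integrable (fun z => z i) (centredGaussian S) :=
  (integrable_centredGaussian_iff S (by fun_prop)).2
    ((memLp_eval_multivariateGaussian S i).integrable (by norm_num))

lemma integral_eval_multivariateGaussian (S : Matrix (Fin D) (Fin D) ℝ) (i : Fin D) :
    ∫ z, z i ∂multivariateGaussian (0 : EuclideanSpace ℝ (Fin D)) S = 0 := by
  have h := (EuclideanSpace.proj (𝕜 := ℝ) i).integral_comp_comm
    (IsGaussian.integrable_fun_id (μ := multivariateGaussian (0 : EuclideanSpace ℝ (Fin D)) S))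
  rw [integral_id_multivariateGaussian] at h
  simpa using h

lemma integral_eval_centredGaussian (S : Matrix (Fin D) (Fin D) ℝ) (i : Fin D) :
    ∫ z, z i ∂centredGaussian S = 0 := by
  rw [integral_centredGaussian S (by fun_prop)]
  exact integral_eval_multivariateGaussian S i

lemma integrable_mul_centredGaussian (S : Matrix (Fin D) (Fin D) ℝ) (i j : Fin D) :
    Integrable (fun z => z i * z j) (centredGaussian S) :=
  (integrable_centredGaussian_iff S (by fun_prop)).2
    ((memLp_eval_multivariateGaussian S i).integrable_mul (memLp_eval_multivariateGaussian S j))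

lemma integral_mul_centredGaussian {S : Matrix (Fin D) (Fin D) ℝ} (hS : S.PosSemidef)
    (i j : Fin D) : ∫ z, z i * z j ∂centredGaussian S = S i j := by
  rw [integral_centredGaussian S (by fun_prop), ← covariance_eval_multivariateGaussian hS
    (μ := 0), covariance]
  simp [integral_eval_multivariateGaussian]

lemma centredGaussian_add {S R : Matrix (Fin D) (Fin D) ℝ} (hS : S.PosSemidef)
    (hR : R.PosSemidef) :
    centredGaussian (S + R) = Measure.conv (centredGaussian S) (centredGaussian R) := by
  have h : multivariateGaussian (0 : EuclideanSpace ℝ (Fin D)) (S + R) =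
      Measure.conv (multivariateGaussian 0 S) (multivariateGaussian 0 R) := by
    refine Measure.ext_of_charFun ?_
    ext x
    rw [charFun_conv, charFun_multivariateGaussian (hS.add hR), charFun_multivariateGaussian hS,
      charFun_multivariateGaussian hR, ← Complex.exp_add, Matrix.add_mulVec, dotProduct_add]
    congr 1
    push_cast
    simp only [inner_zero_right]
    push_cast
    ring
  have h2 := Measure.map_conv_continuousLinearMap
    (μ := multivariateGaussian (0 : EuclideanSpace ℝ (Fin D)) S) (ν := multivariateGaussian 0 R)
    (EuclideanSpace.equiv (Fin D) ℝ).toContinuousLinearMap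
  rw [← h] at h2
  exact h2

lemma posSemidef_single (d : Fin D) {τ : ℝ} (hτ : 0 ≤ τ) :
    (Matrix.diagonal (τ • (Pi.single d 1 : Fin D → ℝ))).PosSemidef := by
  refine Matrix.PosSemidef.diagonal fun i => ?_
  rcases eq_or_ne i d with rfl | h
  · simpa using hτ
  · simp [h]

lemma centredGaussian_single (d : Fin D) (τ : ℝ≥0) :
    centredGaussian (Matrix.diagonal ((τ : ℝ) • (Pi.single d 1 : Fin D → ℝ))) =
      (gaussianReal 0 τ).map fun z => z • (Pi.single d 1 : Fin D → ℝ) := by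
  have h : multivariateGaussian (0 : EuclideanSpace ℝ (Fin D))
      (Matrix.diagonal ((τ : ℝ) • (Pi.single d 1 : Fin D → ℝ))) =
      (gaussianReal 0 τ).map fun z => toLp 2 (z • (Pi.single d 1 : Fin D → ℝ)) := by
    refine Measure.ext_of_charFun ?_
    ext x
    have h1 : ∀ z : ℝ, ⟪toLp 2 (z • (Pi.single d 1 : Fin D → ℝ)), x⟫ = ⟪z, x d⟫ := by
      intro z
      simp [PiLp.inner_apply, mul_comm]
    rw [charFun_multivariateGaussian (posSemidef_single d τ.coe_nonneg), charFun_apply,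
      integral_map (by fun_prop) (by fun_prop)]
    simp_rw [h1]
    rw [← charFun_apply, charFun_gaussianReal]
    have h2 : ofLp x ⬝ᵥ Matrix.diagonal ((τ : ℝ) • (Pi.single d 1 : Fin D → ℝ)) *ᵥ ofLp x
        = τ * x d ^ 2 := by
      simp only [dotProduct, Matrix.mulVec_diagonal, Pi.smul_apply, Pi.single_apply, smul_eq_mul,
        mul_ite, mul_one, mul_zero, ite_mul, zero_mul, Finset.sum_ite_eq', Finset.mem_univ, if_true]
      ring
    rw [h2]
    congr 1
    simp
  rw [centredGaussian, h, Measure.map_map (by fun_prop) (by fun_prop)]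
  rfl

lemma hasGaussianComponents_centredGaussian {S : Matrix (Fin D) (Fin D) ℝ} {τ : ℝ≥0}
    (hS : ∀ d, (S - Matrix.diagonal ((τ : ℝ) • (Pi.single d 1 : Fin D → ℝ))).PosSemidef) :
    HasGaussianComponents τ (centredGaussian S) := by
  intro d
  refine ⟨centredGaussian (S - Matrix.diagonal ((τ : ℝ) • (Pi.single d 1 : Fin D → ℝ))),
    inferInstance, ?_⟩
  rw [← centredGaussian_single, ← centredGaussian_add (posSemidef_single d τ.coe_nonneg) (hS d)]
  simp

lemma norm_sqrt_apply_sq {S : Matrix (Fin D) (Fin D) ℝ} (hS : S.PosSemidef)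
    (w : EuclideanSpace ℝ (Fin D)) :
    ‖toEuclideanCLM (𝕜 := ℝ) (CFC.sqrt S) w‖ ^ 2 = ofLp w ⬝ᵥ S *ᵥ ofLp w := by
  rw [← inner_toEuclideanCLM, ← real_inner_self_eq_norm_sq]
  have h2 : IsSelfAdjoint (toEuclideanCLM (𝕜 := ℝ) (CFC.sqrt S)) :=
    (CFC.sqrt_nonneg S).isSelfAdjoint.map _
  conv_rhs => rw [← CFC.sqrt_mul_sqrt_self S hS.nonneg, map_mul, mul_apply_eq_comp,
    ← h2.adjoint_eq, ContinuousLinearMap.adjoint_inner_right]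
  rw [h2.adjoint_eq]

/-- Absolute moment of order `p` of the standard Gaussian measure. -/
def stdMoment (D : ℕ) (p : ℝ) : ℝ := ∫ w, ‖w‖ ^ p ∂stdGaussian (EuclideanSpace ℝ (Fin D))

lemma stdMoment_nonneg (p : ℝ) : 0 ≤ stdMoment D p :=
  integral_nonneg fun w => Real.rpow_nonneg (norm_nonneg w) p

lemma integrable_norm_rpow_stdGaussian {p : ℝ} (hp : 0 < p) :
    Integrable (fun w => ‖w‖ ^ p) (stdGaussian (EuclideanSpace ℝ (Fin D))) := by
  have := (IsGaussian.memLp_id (stdGaussian (EuclideanSpace ℝ (Fin D)))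
    (ENNReal.ofReal p) (by simp)).integrable_norm_rpow (by simpa using hp) (by simp)
  simpa [ENNReal.toReal_ofReal hp.le] using this

lemma moment_centredGaussian {S : Matrix (Fin D) (Fin D) ℝ} (hS : S.PosSemidef) {v : ℝ}
    (hv : ∀ y : Fin D → ℝ, y ⬝ᵥ S *ᵥ y ≤ v * en y ^ 2) (hv0 : 0 ≤ v) {p : ℝ} (hp : 0 < p) :
    Integrable (fun z => en z ^ p) (centredGaussian S) ∧
      ∫ z, en z ^ p ∂centredGaussian S ≤ v ^ (p / 2) * stdMoment D p := by
  have hc : Continuous fun z : Fin D → ℝ => en z ^ p :=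
    continuous_en.rpow_const fun _ => Or.inr hp.le
  have hle : ∀ w : EuclideanSpace ℝ (Fin D),
      en (ofLp (toEuclideanCLM (𝕜 := ℝ) (CFC.sqrt S) w)) ^ p ≤ v ^ (p / 2) * ‖w‖ ^ p := by
    intro w
    have h1 : ‖toEuclideanCLM (𝕜 := ℝ) (CFC.sqrt S) w‖ ≤ √v * ‖w‖ := by
      refine abs_le_of_sq_le_sq' ?_ (by positivity) |>.2
      rw [norm_sqrt_apply_sq hS, mul_pow, Real.sq_sqrt hv0]
      simpa [en_eq_norm] using hv (ofLp w)
    rw [en_eq_norm, toLp_ofLp]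
    refine (Real.rpow_le_rpow (norm_nonneg _) h1 hp.le).trans (le_of_eq ?_)
    rw [Real.mul_rpow (by positivity) (by positivity), Real.sqrt_eq_rpow, ← Real.rpow_mul hv0]
    congr 2
    ring
  have hI := (integrable_norm_rpow_stdGaussian (D := D) hp).const_mul (v ^ (p / 2))
  have hI2 : Integrable (fun w : EuclideanSpace ℝ (Fin D) =>
      en (ofLp (toEuclideanCLM (𝕜 := ℝ) (CFC.sqrt S) w)) ^ p) (stdGaussian _) := by
    refine hI.mono' (Continuous.aestronglyMeasurable (hc.comp (by fun_prop)))
      (Eventually.of_forall fun w => ?_)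
    rw [Real.norm_eq_abs, abs_of_nonneg (Real.rpow_nonneg (en_nonneg _) _)]
    exact hle w
  have hm : multivariateGaussian (0 : EuclideanSpace ℝ (Fin D)) S =
      (stdGaussian (EuclideanSpace ℝ (Fin D))).map
        fun x => toEuclideanCLM (𝕜 := ℝ) (CFC.sqrt S) x := by
    simp [multivariateGaussian]
  have hc' : Continuous fun z : EuclideanSpace ℝ (Fin D) => en (ofLp z) ^ p :=
    hc.comp (by fun_prop)
  constructor
  · rw [integrable_centredGaussian_iff S hc, hm,
      integrable_map_measure hc'.aestronglyMeasurable (by fun_prop)]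
    exact hI2
  · rw [integral_centredGaussian S hc, hm,
      integral_map (by fun_prop) hc'.aestronglyMeasurable, stdMoment, ← integral_const_mul]
    exact integral_mono hI2 hI hle

end GaussianMeasures

section Families

open MeasureTheory ProbabilityTheory Filter Topology

variable {D : ℕ}

/-- A bounded, Hölder continuous, uniformly elliptic family of symmetric matrices on `[0,1]`. -/
structure EllipticCoeff (δ δ' α K MA : ℝ) (A : ℝ → Matrix (Fin D) (Fin D) ℝ) : Prop where
  nonneg : 0 ≤ K
  symm : ∀ t i j, A t i j = A t j i
  bd : ∀ t ∈ Icc (0 : ℝ) 1, ∀ i j, |A t i j| ≤ MA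
  hol : ∀ t ∈ Icc (0 : ℝ) 1, ∀ s ∈ Icc (0 : ℝ) 1, ∀ i j, |A t i j - A s i j| ≤ K * |t - s| ^ α
  lower : ∀ t ∈ Icc (0 : ℝ) 1, ∀ y : Fin D → ℝ,
    δ * (∑ i, y i ^ 2) ≤ ∑ i, ∑ j, y i * A t i j * y j
  upper : ∀ t ∈ Icc (0 : ℝ) 1, ∀ y : Fin D → ℝ,
    (∑ i, ∑ j, y i * A t i j * y j) ≤ δ' * (∑ i, y i ^ 2)

/-- The measures governing the backward heat equation with coefficient matrix `A`. -/
structure HeatFamily (δ κ α K : ℝ) (A : ℝ → Matrix (Fin D) (Fin D) ℝ)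
    (μ : ℝ → ℝ → Measure (Fin D → ℝ)) : Prop where
  prob : ∀ t s, IsProbabilityMeasure (μ t s)
  conv : ∀ t m s, 0 ≤ t → t ≤ m → m ≤ s → s ≤ 1 → μ t s = Measure.conv (μ t m) (μ m s)
  smooth : ∀ t s, 0 ≤ t → t < s → s ≤ 1 → HasGaussianComponents (δ * (s - t)).toNNReal (μ t s)
  mean_int : ∀ t s i, Integrable (fun z => z i) (μ t s)
  mean : ∀ t s i, ∫ z, z i ∂μ t s = 0
  cov_int : ∀ t s i j, Integrable (fun z => z i * z j) (μ t s)
  cov : ∀ t s, 0 ≤ t → t ≤ s → s ≤ 1 → ∀ i j,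
    |(∫ z, z i * z j ∂μ t s) - (s - t) * A s i j| ≤ K * (s - t) ^ (1 + α)
  moment : ∀ t s, 0 ≤ t → t ≤ s → s ≤ 1 → ∀ p, p = α ∨ p = 2 + α →
    Integrable (fun z => en z ^ p) (μ t s) ∧ ∫ z, en z ^ p ∂μ t s ≤ κ * (s - t) ^ (p / 2)

lemma continuousOn_of_hol {A : ℝ → ℝ} {α K : ℝ} (hα : 0 < α) {s : Set ℝ}
    (h : ∀ t ∈ s, ∀ r ∈ s, |A t - A r| ≤ K * |t - r| ^ α) : ContinuousOn A s := by
  intro t ht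
  rw [ContinuousWithinAt, tendsto_iff_dist_tendsto_zero]
  have h1 : Tendsto (fun r => K * |r - t| ^ α) (𝓝[s] t) (𝓝 0) := by
    have : Continuous fun r : ℝ => K * |r - t| ^ α :=
      continuous_const.mul ((by fun_prop : Continuous fun r : ℝ => |r - t|).rpow_const
        fun _ => Or.inr hα.le)
    have h2 := (this.tendsto t).mono_left (nhdsWithin_le_nhds (s := s))
    simpa [Real.zero_rpow hα.ne'] using h2
  refine squeeze_zero' (Eventually.of_forall fun _ => dist_nonneg) ?_ h1
  filter_upwards [self_mem_nhdsWithin] with r hr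
  rw [Real.dist_eq]
  exact h r hr t ht

/-- The covariance matrix `∫_t^s A`. -/
def covInt (A : ℝ → Matrix (Fin D) (Fin D) ℝ) (t s : ℝ) : Matrix (Fin D) (Fin D) ℝ :=
  fun i j => ∫ u in t..s, A u i j

variable {δ δ' α K MA : ℝ} {A : ℝ → Matrix (Fin D) (Fin D) ℝ}

lemma EllipticCoeff.intervalIntegrable (h : EllipticCoeff δ δ' α K MA A) (hα : 0 < α) {t s : ℝ}
    (ht : 0 ≤ t) (hts : t ≤ s) (hs : s ≤ 1) (i j : Fin D) :
    IntervalIntegrable (fun u => A u i j) volume t s := by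
  refine ContinuousOn.intervalIntegrable ?_
  rw [uIcc_of_le hts]
  exact (continuousOn_of_hol hα fun a ha b hb => h.hol a ha b hb i j).mono
    (Icc_subset_Icc ht hs)

lemma dotProduct_mulVec_eq (S : Matrix (Fin D) (Fin D) ℝ) (y : Fin D → ℝ) :
    y ⬝ᵥ S *ᵥ y = ∑ i, ∑ j, y i * S i j * y j := by
  simp [dotProduct, Matrix.mulVec, Finset.mul_sum, mul_assoc]

lemma EllipticCoeff.quadratic (h : EllipticCoeff δ δ' α K MA A) (hα : 0 < α) {t s : ℝ}
    (ht : 0 ≤ t) (hts : t ≤ s) (hs : s ≤ 1) (y : Fin D → ℝ) :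
    δ * (s - t) * (∑ i, y i ^ 2) ≤ y ⬝ᵥ covInt A t s *ᵥ y ∧
      y ⬝ᵥ covInt A t s *ᵥ y ≤ δ' * (s - t) * (∑ i, y i ^ 2) := by
  have h_int : ∀ i j, IntervalIntegrable (fun u => y i * A u i j * y j) volume t s := fun i j =>
    ((h.intervalIntegrable hα ht hts hs i j).const_mul _).mul_const _
  have hint2 : ∀ i, IntervalIntegrable (fun u => ∑ j, y i * A u i j * y j) volume t s := fun i =>
    (IntervalIntegrable.sum Finset.univ fun j _ => h_int i j).congr (by
      intro u _; simp)
  have hint3 : IntervalIntegrable (fun u => ∑ i, ∑ j, y i * A u i j * y j) volume t s :=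
    (IntervalIntegrable.sum Finset.univ fun i _ => hint2 i).congr (by
      intro u _; simp)
  have heq : y ⬝ᵥ covInt A t s *ᵥ y = ∫ u in t..s, ∑ i, ∑ j, y i * A u i j * y j := by
    rw [dotProduct_mulVec_eq, intervalIntegral.integral_finsetSum fun i _ => hint2 i]
    refine Finset.sum_congr rfl fun i _ => ?_
    rw [intervalIntegral.integral_finsetSum fun j _ => h_int i j]
    refine Finset.sum_congr rfl fun j _ => ?_
    rw [intervalIntegral.integral_mul_const, intervalIntegral.integral_const_mul]
    rfl
  have hmem : ∀ u ∈ Icc t s, u ∈ Icc (0 : ℝ) 1 := fun u hu => ⟨ht.trans hu.1, hu.2.trans hs⟩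
  rw [heq]
  constructor
  · have := intervalIntegral.integral_mono_on hts
      (intervalIntegrable_const (c := δ * ∑ i, y i ^ 2)) hint3
      fun u hu => h.lower u (hmem u hu) y
    rw [intervalIntegral.integral_const, smul_eq_mul] at this
    linarith
  · have := intervalIntegral.integral_mono_on hts hint3
      (intervalIntegrable_const (c := δ' * ∑ i, y i ^ 2))
      fun u hu => h.upper u (hmem u hu) y
    rw [intervalIntegral.integral_const, smul_eq_mul] at this
    linarith

lemma EllipticCoeff.isHermitian (h : EllipticCoeff δ δ' α K MA A) (t s : ℝ) :
    (covInt A t s).IsHermitian := by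
  ext i j
  simp [covInt, h.symm _ i j]

lemma EllipticCoeff.posSemidef (h : EllipticCoeff δ δ' α K MA A) (hα : 0 < α) (hδ : 0 ≤ δ)
    {t s : ℝ} (ht : 0 ≤ t) (hts : t ≤ s) (hs : s ≤ 1) : (covInt A t s).PosSemidef := by
  refine .of_dotProduct_mulVec_nonneg (h.isHermitian t s) fun y => ?_
  refine le_trans ?_ (h.quadratic hα ht hts hs y).1
  have := sub_nonneg.2 hts
  positivity

lemma EllipticCoeff.covInt_sub_le (h : EllipticCoeff δ δ' α K MA A) (hα : 0 < α)
    {t s : ℝ} (ht : 0 ≤ t) (hts : t ≤ s) (hs : s ≤ 1) (i j : Fin D) :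
    |covInt A t s i j - (s - t) * A s i j| ≤ K * (s - t) ^ (1 + α) := by
  have h1 : covInt A t s i j - (s - t) * A s i j = ∫ u in t..s, (A u i j - A s i j) := by
    rw [intervalIntegral.integral_sub (h.intervalIntegrable hα ht hts hs i j)
      intervalIntegrable_const, intervalIntegral.integral_const]
    rfl
  have h2 := intervalIntegral.norm_integral_le_of_norm_le_const (a := t) (b := s)
    (f := fun u => A u i j - A s i j) (C := K * (s - t) ^ α) (by
      intro u hu
      rw [uIoc_of_le hts] at hu
      refine (h.hol u ⟨ht.trans hu.1.le, hu.2.trans hs⟩ s ⟨ht.trans hts, hs⟩ i j).trans ?_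
      rw [abs_sub_comm, abs_of_nonneg (sub_nonneg.2 hu.2)]
      exact mul_le_mul_of_nonneg_left (Real.rpow_le_rpow (sub_nonneg.2 hu.2)
        (by linarith [hu.1]) hα.le) h.nonneg)
  rw [h1, ← Real.norm_eq_abs]
  refine h2.trans (le_of_eq ?_)
  rw [abs_of_nonneg (sub_nonneg.2 hts)]
  rcases hts.eq_or_lt with rfl | hlt
  · simp [Real.zero_rpow (by positivity : 1 + α ≠ 0)]
  · rw [Real.rpow_add (sub_pos.2 hlt), Real.rpow_one]
    ring

/-- The moment constant of the heat family. -/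
def momentConst (D : ℕ) (δ' α : ℝ) : ℝ :=
  δ' ^ (α / 2) * stdMoment D α + δ' ^ ((2 + α) / 2) * stdMoment D (2 + α)

lemma momentConst_nonneg (hδ' : 0 ≤ δ') : 0 ≤ momentConst D δ' α := by
  have h1 := stdMoment_nonneg (D := D) α
  have h2 := stdMoment_nonneg (D := D) (2 + α)
  unfold momentConst
  positivity

lemma EllipticCoeff.heatFamily (h : EllipticCoeff δ δ' α K MA A) (hα : 0 < α) (hδ : 0 ≤ δ)
    (hδ' : 0 ≤ δ') : HeatFamily δ (momentConst D δ' α) α K A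
      fun t s => centredGaussian (covInt A t s) where
  prob t s := inferInstance
  conv t m s ht htm hms hs := by
    rw [← centredGaussian_add (h.posSemidef hα hδ ht htm (hms.trans hs))
      (h.posSemidef hα hδ (ht.trans htm) hms hs)]
    congr 1
    ext i j
    exact (intervalIntegral.integral_add_adjacent_intervals
      (h.intervalIntegrable hα ht htm (hms.trans hs) i j)
      (h.intervalIntegrable hα (ht.trans htm) hms hs i j)).symm
  smooth t s ht hts hs := by
    have hst := sub_nonneg.2 hts.le
    refine hasGaussianComponents_centredGaussian fun d => ?_
    rw [Real.coe_toNNReal _ (by positivity)]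
    refine .of_dotProduct_mulVec_nonneg ?_ fun y => ?_
    · exact (h.isHermitian t s).sub (Matrix.isHermitian_diagonal _)
    · have h1 := (h.quadratic hα ht hts.le hs y).1
      have h2 : y ⬝ᵥ Matrix.diagonal ((δ * (s - t)) • (Pi.single d 1 : Fin D → ℝ)) *ᵥ y
          = δ * (s - t) * y d ^ 2 := by
        simp only [dotProduct, Matrix.mulVec_diagonal, Pi.smul_apply, Pi.single_apply, smul_eq_mul,
          mul_ite, mul_one, mul_zero, ite_mul, zero_mul, Finset.sum_ite_eq', Finset.mem_univ,
          if_true]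
        ring
      have h3 : y d ^ 2 ≤ ∑ i, y i ^ 2 := Finset.single_le_sum (f := fun i => y i ^ 2)
        (fun i _ => sq_nonneg _) (Finset.mem_univ d)
      rw [Matrix.sub_mulVec, dotProduct_sub, star_trivial, h2, sub_nonneg]
      exact (mul_le_mul_of_nonneg_left h3 (by positivity)).trans h1
  mean_int t s i := integrable_eval_centredGaussian _ i
  mean t s i := integral_eval_centredGaussian _ i
  cov_int t s i j := integrable_mul_centredGaussian _ i j
  cov t s ht hts hs i j := by
    rw [integral_mul_centredGaussian (h.posSemidef hα hδ ht hts hs)]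
    exact h.covInt_sub_le hα ht hts hs i j
  moment t s ht hts hs p hp := by
    have hst := sub_nonneg.2 hts
    have hp0 : 0 < p := by rcases hp with rfl | rfl <;> positivity
    have h1 := moment_centredGaussian (h.posSemidef hα hδ ht hts hs) (v := δ' * (s - t))
      (fun y => by
        rw [en, Real.sq_sqrt (Finset.sum_nonneg fun i _ => sq_nonneg _)]
        exact (h.quadratic hα ht hts hs y).2) (by positivity) hp0
    refine ⟨h1.1, h1.2.trans ?_⟩
    rw [Real.mul_rpow hδ' hst, mul_right_comm]
    refine mul_le_mul_of_nonneg_right ?_ (by positivity)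
    have h2 := stdMoment_nonneg (D := D) α
    have h3 := stdMoment_nonneg (D := D) (2 + α)
    rcases hp with rfl | rfl
    · exact le_add_of_nonneg_right (by positivity)
    · exact le_add_of_nonneg_left (by positivity)

lemma ellipticCoeff_mul_transpose {C : ℝ → Matrix (Fin D) (Fin D) ℝ} {K : ℝ}
    (hK : ∀ t ∈ Set.Icc (0:ℝ) 1, ∀ s ∈ Set.Icc (0:ℝ) 1, ∀ i j,
        |C t i j - C s i j| ≤ K * |t - s| ^ α) (hC : Ellip D δ δ' C) :
    ∃ K' MA, EllipticCoeff δ δ' α K' MA fun t => C t * (C t)ᵀ := by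
  have hd : ∀ t ∈ Icc (0 : ℝ) 1, ∀ i k, |C t i k| ≤ √δ' := by
    intro t ht i k
    have h1 := (hC t ht (Pi.single i 1)).2
    have h2 : ∑ a, ∑ b, (Pi.single i 1 : Fin D → ℝ) a * (C t * (C t)ᵀ) a b *
        (Pi.single i 1 : Fin D → ℝ) b = ∑ k, C t i k ^ 2 := by
      simp [Pi.single_apply, Matrix.mul_apply, sq]
    have h3 : ∑ a, (Pi.single i 1 : Fin D → ℝ) a ^ 2 = 1 := by
      simp [Pi.single_apply]
    rw [h2, h3, mul_one] at h1
    refine Real.abs_le_sqrt (le_trans ?_ h1)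
    exact Finset.single_le_sum (f := fun k => C t i k ^ 2) (fun k _ => sq_nonneg _)
      (Finset.mem_univ k)
  have hent : ∀ t i j, (C t * (C t)ᵀ) i j = ∑ k, C t i k * C t j k := fun t i j => by
    simp [Matrix.mul_apply]
  have hs := Real.sqrt_nonneg δ'
  refine ⟨∑ _k : Fin D, 2 * √δ' * |K|, ∑ _k : Fin D, √δ' * √δ', ⟨by positivity, ?_, ?_, ?_,
    fun t ht y => (hC t ht y).1, fun t ht y => (hC t ht y).2⟩⟩
  · intro t i j
    rw [hent, hent]
    exact Finset.sum_congr rfl fun k _ => mul_comm _ _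
  · intro t ht i j
    rw [hent]
    refine (Finset.abs_sum_le_sum_abs _ _).trans (Finset.sum_le_sum fun k _ => ?_)
    rw [abs_mul]
    exact mul_le_mul (hd t ht i k) (hd t ht j k) (abs_nonneg _) hs
  · intro t ht s hs' i j
    rw [hent, hent, ← Finset.sum_sub_distrib, Finset.sum_mul]
    refine (Finset.abs_sum_le_sum_abs _ _).trans (Finset.sum_le_sum fun k _ => ?_)
    have e : C t i k * C t j k - C s i k * C s j k =
      C t i k * (C t j k - C s j k) + (C t i k - C s i k) * C s j k := by ring
    have hb : ∀ i k, |C t i k - C s i k| ≤ |K| * |t - s| ^ α := fun i k =>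
      (hK t ht s hs' i k).trans (mul_le_mul_of_nonneg_right (le_abs_self K)
        (Real.rpow_nonneg (abs_nonneg _) _))
    rw [e]
    refine (abs_add_le _ _).trans ?_
    rw [abs_mul, abs_mul]
    have h1 := mul_le_mul (hd t ht i k) (hb j k) (abs_nonneg _) hs
    have h2 := mul_le_mul (hb i k) (hd s hs' j k) (abs_nonneg _) ((abs_nonneg _).trans (hb i k))
    linarith

end Families

section Semigroup

open MeasureTheory ProbabilityTheory Filter Topology

variable {D : ℕ}

/-- Functions with bounded derivatives up to order two, the second ones being Hölder. -/
structure BoundedC2 (α M N H : ℝ) (F : (Fin D → ℝ) → ℝ) : Prop where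
  contDiff : ContDiff ℝ 2 F
  bd : ∀ x, |F x| ≤ M
  pd_bd : ∀ d x, |pd F d x| ≤ N
  pdd_hol : ∀ d e, BH α N H (pdd F d e)

lemma BoundedC2.contDiff_one {α M N H : ℝ} {F : (Fin D → ℝ) → ℝ} (h : BoundedC2 α M N H F) :
    ContDiff ℝ 1 F := h.contDiff.of_le (by norm_num)

lemma avg_C2 {α M N H : ℝ} {F : (Fin D → ℝ) → ℝ} (hα : 0 < α) (h : BoundedC2 α M N H F)
    (μ : Measure (Fin D → ℝ)) [IsProbabilityMeasure μ] :
    BoundedC2 α M N H (avg μ F) ∧ (∀ d, pd (avg μ F) d = avg μ (pd F d)) ∧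
      ∀ d e, pdd (avg μ F) d e = avg μ (pdd F d e) := by
  have h1 := avg_C1 h.contDiff_one h.bd h.pd_bd μ
  have h2 := fun e => avg_C1 (contDiff_pd h.contDiff e) (h.pd_bd e)
    (fun d x => (h.pdd_hol d e).bd x) μ
  have h3 : ∀ d e, pdd (avg μ F) d e = avg μ (pdd F d e) := by
    intro d e
    have : pdd (avg μ F) d e = pd (pd (avg μ F) e) d := rfl
    rw [this, h1.2 e, (h2 e).2 d]
    rfl
  refine ⟨⟨contDiff_two_of_pd h1.1 fun e => ?_, abs_avg_le h.bd, fun d => ?_, fun d e => ?_⟩,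
    h1.2, h3⟩
  · rw [h1.2 e]; exact (h2 e).1
  · rw [h1.2 d]; exact abs_avg_le (h.pd_bd d)
  · rw [h3 d e]; exact (h.pdd_hol d e).avg hα μ

lemma le_of_hasDerivAt_segment {f f' : ℝ → ℝ} {B : ℝ} (hf : ∀ r, HasDerivAt f (f' r) r)
    (hB : ∀ r ∈ Icc (0 : ℝ) 1, |f' r| ≤ B) {r : ℝ} (hr : r ∈ Icc (0 : ℝ) 1) :
    |f r - f 0| ≤ B := by
  have := norm_image_sub_le_of_norm_deriv_le_segment' (a := 0) (b := 1) (f := f) (f' := f')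
    (C := B) (fun x _ => (hf x).hasDerivWithinAt) (fun x hx => hB x ⟨hx.1, hx.2.le⟩) r hr
  rw [Real.norm_eq_abs, sub_zero] at this
  have hB0 : 0 ≤ B := (abs_nonneg _).trans (hB 0 (by simp))
  nlinarith [hr.2]

lemma taylor_two {α M N H : ℝ} {F : (Fin D → ℝ) → ℝ} (hα : 0 < α) (h : BoundedC2 α M N H F)
    (x z : Fin D → ℝ) :
    |F (x + z) - F x - (∑ d, z d * pd F d x) - 1 / 2 * ∑ i, ∑ j, z i * z j * pdd F i j x|
      ≤ D ^ 2 * H * en z ^ (2 + α) := by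
  rcases (en_nonneg z).eq_or_lt with h0 | hz
  · have : z = 0 := eq_of_en_eq_zero h0.symm
    subst this
    simp [Real.zero_rpow (by positivity : 2 + α ≠ 0)]
  set ψ : Fin D → ℝ → ℝ := fun j r =>
    pd F j (x + r • z) - pd F j x - r * ∑ i, z i * pdd F i j x with hψ
  have hψd : ∀ j r, HasDerivAt (ψ j)
      (∑ i, z i * (pdd F i j (x + r • z) - pdd F i j x)) r := by
    intro j r
    have h1 := ((hasDerivAt_along (contDiff_pd h.contDiff j) x z r).sub_const (pd F j x)).sub
      ((hasDerivAt_id r).mul_const (∑ i, z i * pdd F i j x))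
    refine h1.congr_deriv ?_
    rw [one_mul, ← Finset.sum_sub_distrib]
    exact Finset.sum_congr rfl fun i _ => (mul_sub _ _ _).symm
  have hψb : ∀ j, ∀ r ∈ Icc (0 : ℝ) 1, |ψ j r| ≤ D * H * en z ^ (1 + α) := by
    intro j r hr
    have h0 : ψ j 0 = 0 := by simp [hψ]
    have := le_of_hasDerivAt_segment (hψd j) (B := D * H * en z ^ (1 + α)) (fun r hr => by
      refine (Finset.abs_sum_le_sum_abs _ _).trans ?_
      have : ∀ i ∈ (Finset.univ : Finset (Fin D)),
          |z i * (pdd F i j (x + r • z) - pdd F i j x)| ≤ en z * (H * en z ^ α) := by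
        intro i _
        have hH := (h.pdd_hol i j).nonneg
        rw [abs_mul]
        refine mul_le_mul (abs_le_en _ _) (((h.pdd_hol i j).hol _ _).trans ?_) (abs_nonneg _) hz.le
        refine mul_le_mul_of_nonneg_left (Real.rpow_le_rpow (en_nonneg _) ?_ hα.le) hH
        rw [add_sub_cancel_left, en_eq_norm, en_eq_norm, WithLp.toLp_smul, norm_smul,
          Real.norm_eq_abs, abs_of_nonneg hr.1]
        exact mul_le_of_le_one_left (norm_nonneg _) hr.2
      refine (Finset.sum_le_sum this).trans (le_of_eq ?_)
      simp only [Finset.sum_const, Finset.card_univ, Fintype.card_fin, nsmul_eq_mul]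
      rw [Real.rpow_add hz, Real.rpow_one]
      ring) hr
    rwa [h0, sub_zero] at this
  set φ : ℝ → ℝ := fun r => F (x + r • z) - r * (∑ j, z j * pd F j x)
    - r ^ 2 * (1 / 2 * ∑ i, ∑ j, z i * z j * pdd F i j x) with hφ
  have hφd : ∀ r, HasDerivAt φ (∑ j, z j * ψ j r) r := by
    intro r
    have h1 := ((hasDerivAt_along h.contDiff_one x z r).sub
      ((hasDerivAt_id r).mul_const (∑ j, z j * pd F j x))).sub
      ((hasDerivAt_pow 2 r).mul_const (1 / 2 * ∑ i, ∑ j, z i * z j * pdd F i j x))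
    refine h1.congr_deriv ?_
    have e1 : ∑ j, z j * ψ j r = ∑ j, z j * pd F j (x + r • z) - ∑ j, z j * pd F j x
        - r * ∑ j, ∑ i, z i * z j * pdd F i j x := by
      rw [Finset.mul_sum, ← Finset.sum_sub_distrib, ← Finset.sum_sub_distrib]
      refine Finset.sum_congr rfl fun j _ => ?_
      simp only [hψ, mul_sub, Finset.mul_sum]
      congr 1
      exact Finset.sum_congr rfl fun i _ => by ring
    rw [e1, Finset.sum_comm (γ := Fin D)]
    push_cast
    ring
  have := le_of_hasDerivAt_segment hφd (B := D ^ 2 * H * en z ^ (2 + α)) (fun r hr => by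
    refine (Finset.abs_sum_le_sum_abs _ _).trans ?_
    have : ∀ j ∈ (Finset.univ : Finset (Fin D)),
        |z j * ψ j r| ≤ en z * (D * H * en z ^ (1 + α)) := by
      intro j _
      rw [abs_mul]
      exact mul_le_mul (abs_le_en _ _) (hψb j r hr) (abs_nonneg _) hz.le
    refine (Finset.sum_le_sum this).trans (le_of_eq ?_)
    simp only [Finset.sum_const, Finset.card_univ, Fintype.card_fin, nsmul_eq_mul]
    rw [show 2 + α = 1 + (1 + α) by ring, Real.rpow_add hz 1 (1 + α), Real.rpow_one]
    ring) (r := 1) (by simp)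
  refine le_trans (le_of_eq ?_) this
  congr 1
  simp only [hφ, one_smul, zero_smul, add_zero]
  ring

variable {δ κ α K : ℝ} {A : ℝ → Matrix (Fin D) (Fin D) ℝ} {μ : ℝ → ℝ → Measure (Fin D → ℝ)}

lemma HeatFamily.abs_avg_sub_self_le (h : HeatFamily δ κ α K A μ) (hα : 0 < α) {M L : ℝ}
    {F : (Fin D → ℝ) → ℝ} (hF : BH α M L F) {t s : ℝ} (ht : 0 ≤ t) (hts : t ≤ s) (hs : s ≤ 1)
    (x : Fin D → ℝ) : |avg (μ t s) F x - F x| ≤ L * κ * (s - t) ^ (α / 2) := by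
  have := h.prob t s
  have hm := h.moment t s ht hts hs α (Or.inl rfl)
  have h1 : avg (μ t s) F x - F x = ∫ z, (F (x + z) - F x) ∂μ t s := by
    rw [integral_sub (integrable_translate (hF.continuous hα) hF.bd x) (integrable_const _)]
    simp [avg]
  rw [h1, ← Real.norm_eq_abs]
  refine (norm_integral_le_of_norm_le (hm.1.const_mul L) (Eventually.of_forall fun z => ?_)).trans
    ?_
  · simpa using hF.hol (x + z) x
  · rw [integral_const_mul, mul_assoc]
    exact mul_le_mul_of_nonneg_left hm.2 hF.nonneg

lemma HeatFamily.taylor (h : HeatFamily δ κ α K A μ) (hα : 0 < α) {M N H : ℝ}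
    {F : (Fin D → ℝ) → ℝ} (hF : BoundedC2 α M N H F) (hK : 0 ≤ K)
    {t s : ℝ} (ht : 0 ≤ t) (hts : t ≤ s) (hs : s ≤ 1) (x : Fin D → ℝ) :
    |avg (μ t s) F x - F x - (s - t) * (1 / 2 * ∑ i, ∑ j, A s i j * pdd F i j x)|
      ≤ D ^ 2 * (H * κ + K * N) * (s - t) ^ (1 + α / 2) := by
  have := h.prob t s
  have hm := h.moment t s ht hts hs (2 + α) (Or.inr rfl)
  have hst := sub_nonneg.2 hts
  have i1 : Integrable (fun z => F (x + z)) (μ t s) :=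
    integrable_translate hF.contDiff.continuous hF.bd x
  have i2 : Integrable (fun z => ∑ d, z d * pd F d x) (μ t s) :=
    integrable_finsetSum _ fun d _ => (h.mean_int t s d).mul_const _
  have i3' : ∀ i, Integrable (fun z => ∑ j, z i * z j * pdd F i j x) (μ t s) := fun i =>
    integrable_finsetSum _ fun j _ => (h.cov_int t s i j).mul_const _
  have i3 : Integrable (fun z => ∑ i, ∑ j, z i * z j * pdd F i j x) (μ t s) :=
    integrable_finsetSum _ fun i _ => i3' i
  have e2 : ∫ z, ∑ d, z d * pd F d x ∂μ t s = 0 := by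
    rw [integral_finsetSum _ fun d _ => (h.mean_int t s d).mul_const _]
    simp [integral_mul_const, h.mean]
  have e3 : ∫ z, ∑ i, ∑ j, z i * z j * pdd F i j x ∂μ t s =
      ∑ i, ∑ j, (∫ z, z i * z j ∂μ t s) * pdd F i j x := by
    rw [integral_finsetSum _ fun i _ => i3' i]
    refine Finset.sum_congr rfl fun i _ => ?_
    rw [integral_finsetSum _ fun j _ => (h.cov_int t s i j).mul_const _]
    simp [integral_mul_const]
  have h1 : avg (μ t s) F x - F x - 1 / 2 * ∑ i, ∑ j, (∫ z, z i * z j ∂μ t s) * pdd F i j x =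
      ∫ z, (F (x + z) - F x - (∑ d, z d * pd F d x) -
        1 / 2 * ∑ i, ∑ j, z i * z j * pdd F i j x) ∂μ t s := by
    have i4 : Integrable (fun z => F (x + z) - F x) (μ t s) := i1.sub (integrable_const _)
    have i5 : Integrable (fun z => F (x + z) - F x - ∑ d, z d * pd F d x) (μ t s) := i4.sub i2
    rw [integral_sub i5 (i3.const_mul _), integral_sub i4 i2, integral_sub i1 (integrable_const _), e2,
      integral_const_mul, e3]
    simp [avg]
  have h2 : |avg (μ t s) F x - F x - 1 / 2 * ∑ i, ∑ j, (∫ z, z i * z j ∂μ t s) * pdd F i j x|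
      ≤ D ^ 2 * H * (κ * (s - t) ^ (1 + α / 2)) := by
    rw [h1, ← Real.norm_eq_abs]
    refine (norm_integral_le_of_norm_le (hm.1.const_mul (D ^ 2 * H))
      (Eventually.of_forall fun z => taylor_two hα hF x z)).trans ?_
    rw [integral_const_mul]
    rcases Nat.eq_zero_or_pos D with hD | hD
    · subst hD; simp
    · have hH := (hF.pdd_hol ⟨0, hD⟩ ⟨0, hD⟩).nonneg
      refine mul_le_mul_of_nonneg_left (hm.2.trans (le_of_eq ?_)) (by positivity)
      congr 2
      ring
  have h3 : |∑ i, ∑ j, ((∫ z, z i * z j ∂μ t s) - (s - t) * A s i j) * pdd F i j x|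
      ≤ D ^ 2 * (K * (s - t) ^ (1 + α / 2) * N) := by
    have : ∀ i ∈ (Finset.univ : Finset (Fin D)), ∀ j ∈ (Finset.univ : Finset (Fin D)),
        |((∫ z, z i * z j ∂μ t s) - (s - t) * A s i j) * pdd F i j x|
          ≤ K * (s - t) ^ (1 + α / 2) * N := by
      intro i _ j _
      rw [abs_mul]
      refine mul_le_mul ((h.cov t s ht hts hs i j).trans ?_) ((hF.pdd_hol i j).bd x)
        (abs_nonneg _) (by positivity)
      refine mul_le_mul_of_nonneg_left ?_ hK
      rcases hst.eq_or_lt with h0 | h0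
      · rw [← h0, Real.zero_rpow (by positivity), Real.zero_rpow (by positivity)]
      · exact Real.rpow_le_rpow_of_exponent_ge h0 (by linarith) (by linarith)
    refine (Finset.abs_sum_le_sum_abs _ _).trans ((Finset.sum_le_sum fun i hi =>
      (Finset.abs_sum_le_sum_abs _ _).trans (Finset.sum_le_sum (this i hi))).trans (le_of_eq ?_))
    simp only [Finset.sum_const, Finset.card_univ, Fintype.card_fin, nsmul_eq_mul]
    ring
  have h4 : avg (μ t s) F x - F x - (s - t) * (1 / 2 * ∑ i, ∑ j, A s i j * pdd F i j x) =
      (avg (μ t s) F x - F x - 1 / 2 * ∑ i, ∑ j, (∫ z, z i * z j ∂μ t s) * pdd F i j x) +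
      1 / 2 * ∑ i, ∑ j, ((∫ z, z i * z j ∂μ t s) - (s - t) * A s i j) * pdd F i j x := by
    have : (s - t) * (1 / 2 * ∑ i, ∑ j, A s i j * pdd F i j x) =
        1 / 2 * ∑ i, ∑ j, (s - t) * A s i j * pdd F i j x := by
      rw [mul_left_comm]
      simp only [Finset.mul_sum, mul_assoc]
    rw [this]
    simp only [sub_mul, Finset.sum_sub_distrib]
    ring
  rw [h4]
  refine (abs_add_le _ _).trans ?_
  rw [abs_mul, abs_of_nonneg (by norm_num : (0 : ℝ) ≤ 1 / 2)]
  nlinarith [abs_nonneg (∑ i, ∑ j, ((∫ z, z i * z j ∂μ t s) - (s - t) * A s i j) * pdd F i j x)]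

end Semigroup

section HeatSmoothing

open MeasureTheory ProbabilityTheory Filter Topology

variable {D : ℕ} {δ κ α K : ℝ} {A : ℝ → Matrix (Fin D) (Fin D) ℝ}
  {μ : ℝ → ℝ → Measure (Fin D → ℝ)}

lemma HeatFamily.smoothing_C1 (h : HeatFamily δ κ α K A μ) (hα : 0 < α) (hα1 : α ≤ 1)
    (hδ : 0 < δ) {M L : ℝ} {F : (Fin D → ℝ) → ℝ} (hF : BH α M L F) {t s : ℝ} (ht : 0 ≤ t)
    (hts : t < s) (hs : s ≤ 1) :
    ContDiff ℝ 1 (avg (μ t s) F) ∧ ∀ d,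
      BH α (2 * (δ * (s - t)) ^ (-1 / 2 : ℝ) * M) (2 * (δ * (s - t)) ^ (-1 / 2 : ℝ) * L)
        (pd (avg (μ t s) F) d) ∧
      ∀ x, |pd (avg (μ t s) F) d x| ≤ 2 * (δ * (s - t)) ^ ((α - 1) / 2) * L := by
  have := h.prob t s
  have hτ : 0 < δ * (s - t) := mul_pos hδ (sub_pos.2 hts)
  have h1 := smoothing hα hα1 (by simpa using hτ) (h.smooth t s ht hts hs) hF
  rwa [Real.coe_toNNReal _ hτ.le] at h1

lemma HeatFamily.avg_avg (h : HeatFamily δ κ α K A μ) (hα : 0 < α) {M L : ℝ}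
    {F : (Fin D → ℝ) → ℝ} (hF : BH α M L F) {t m s : ℝ} (ht : 0 ≤ t)
    (htm : t ≤ m) (hms : m ≤ s) (hs : s ≤ 1) :
    avg (μ t s) F = avg (μ t m) (avg (μ m s) F) := by
  have := h.prob t m
  have := h.prob m s
  rw [h.conv t m s ht htm hms hs, avg_conv (hF.continuous hα) hF.bd]

lemma HeatFamily.smoothing_C2 (h : HeatFamily δ κ α K A μ) (hα : 0 < α) (hα1 : α ≤ 1)
    (hδ : 0 < δ) {M L : ℝ} {F : (Fin D → ℝ) → ℝ} (hF : BH α M L F) {t s : ℝ} (ht : 0 ≤ t)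
    (hts : t < s) (hs : s ≤ 1) :
    ContDiff ℝ 2 (avg (μ t s) F) ∧ ∀ d e,
      BH α (4 * (δ / 2 * (s - t)) ^ (-1 : ℝ) * M) (4 * (δ / 2 * (s - t)) ^ (-1 : ℝ) * L)
        (pdd (avg (μ t s) F) d e) ∧
      ∀ x, |pdd (avg (μ t s) F) d e x| ≤ 4 * (δ / 2 * (s - t)) ^ (α / 2 - 1) * L := by
  set m := (t + s) / 2 with hm
  have htm : t < m := by rw [hm]; linarith
  have hms : m < s := by rw [hm]; linarith
  have hσ : 0 < δ / 2 * (s - t) := mul_pos (by positivity) (sub_pos.2 hts)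
  have e1 : δ * (m - t) = δ / 2 * (s - t) := by rw [hm]; ring
  have e2 : δ * (s - m) = δ / 2 * (s - t) := by rw [hm]; ring
  have := h.prob t m
  have := h.prob m s
  obtain ⟨hQ, hQd⟩ := h.smoothing_C1 hα hα1 hδ hF (ht.trans htm.le) hms hs
  rw [e2] at hQd
  have h1 := avg_C1 hQ (abs_avg_le hF.bd) (fun d => (hQd d).2) (μ t m)
  have h2 := fun e => h.smoothing_C1 hα hα1 hδ (hQd e).1 ht htm (hms.le.trans hs)
  rw [e1] at h2
  rw [h.avg_avg hα hF ht htm.le hms.le hs]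
  refine ⟨contDiff_two_of_pd h1.1 fun e => ?_, fun d e => ?_⟩
  · rw [h1.2 e]; exact (h2 e).1
  · have e3 : pdd (avg (μ t m) (avg (μ m s) F)) d e =
        pd (avg (μ t m) (pd (avg (μ m s) F) e)) d := by
      rw [← h1.2 e]; rfl
    rw [e3]
    have e4 : (δ / 2 * (s - t)) ^ (-1 / 2 : ℝ) * (δ / 2 * (s - t)) ^ (-1 / 2 : ℝ) =
        (δ / 2 * (s - t)) ^ (-1 : ℝ) := by
      rw [← Real.rpow_add hσ]; norm_num
    have e5 : (δ / 2 * (s - t)) ^ ((α - 1) / 2) * (δ / 2 * (s - t)) ^ (-1 / 2 : ℝ) =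
        (δ / 2 * (s - t)) ^ (α / 2 - 1) := by
      rw [← Real.rpow_add hσ]; congr 1; ring
    constructor
    · refine ((h2 e).2 d).1.mono (le_of_eq ?_) (le_of_eq ?_)
      · rw [← e4]; ring
      · rw [← e4]; ring
    · intro x
      refine (((h2 e).2 d).2 x).trans (le_of_eq ?_)
      rw [← e5]; ring

lemma HeatFamily.boundedC2 (h : HeatFamily δ κ α K A μ) (hα : 0 < α) (hα1 : α ≤ 1)
    (hδ : 0 < δ) {M L : ℝ} {F : (Fin D → ℝ) → ℝ} (hF : BH α M L F) {t s : ℝ} (ht : 0 ≤ t)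
    (hts : t < s) (hs : s ≤ 1) : ∃ N, BoundedC2 α M N (4 * (δ / 2 * (s - t)) ^ (-1 : ℝ) * L)
      (avg (μ t s) F) := by
  have := h.prob t s
  have h1 := h.smoothing_C1 hα hα1 hδ hF ht hts hs
  have h2 := h.smoothing_C2 hα hα1 hδ hF ht hts hs
  exact ⟨_, h2.1, abs_avg_le hF.bd, fun d x => (((h1.2 d).1.bd x)).trans (le_max_left _ _),
    fun d e => (h2.2 d e).1.mono (le_max_right _ _) le_rfl⟩

lemma HeatFamily.pdd_lipschitz (h : HeatFamily δ κ α K A μ) (hα : 0 < α) (hα1 : α ≤ 1)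
    (hδ : 0 < δ) {M L : ℝ} {F : (Fin D → ℝ) → ℝ} (hF : BH α M L F) {t s : ℝ} (ht : 0 ≤ t)
    (hts : t < s) (hs : s ≤ 1) (d e : Fin D) (x y : Fin D → ℝ) :
    |pdd (avg (μ t s) F) d e x - pdd (avg (μ t s) F) d e y| ≤
      D * (8 * (δ / 4 * (s - t)) ^ ((α - 3) / 2) * L) * en (x - y) := by
  set m := (t + s) / 2 with hm
  have htm : t < m := by rw [hm]; linarith
  have hms : m < s := by rw [hm]; linarith
  have hσ : 0 < δ / 4 * (s - t) := mul_pos (by positivity) (sub_pos.2 hts)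
  have e1 : δ * (m - t) = 2 * (δ / 4 * (s - t)) := by rw [hm]; ring
  have e2 : δ / 2 * (s - m) = δ / 4 * (s - t) := by rw [hm]; ring
  have := h.prob t m
  obtain ⟨N, hN⟩ := h.boundedC2 hα hα1 hδ hF (ht.trans htm.le) hms hs
  rw [e2] at hN
  have h2 := avg_C2 hα hN (μ t m)
  rw [h.avg_avg hα hF ht htm.le hms.le hs, h2.2.2 d e]
  have h3 := h.smoothing_C1 hα hα1 hδ (hN.pdd_hol d e) ht htm (hms.le.trans hs)
  rw [e1] at h3
  refine lip_of_pd_bd h3.1 (fun c z => ((h3.2 c).2 z).trans ?_) x y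
  have e4 : (δ / 4 * (s - t)) ^ ((α - 1) / 2) * (δ / 4 * (s - t)) ^ (-1 : ℝ) =
        (δ / 4 * (s - t)) ^ ((α - 3) / 2) := by
      rw [← Real.rpow_add hσ]; congr 1; ring
  have e5 : (2 * (δ / 4 * (s - t))) ^ ((α - 1) / 2) ≤ (δ / 4 * (s - t)) ^ ((α - 1) / 2) :=
    Real.rpow_le_rpow_of_nonpos hσ (by linarith) (by linarith)
  have := hF.nonneg
  calc _ ≤ 2 * (δ / 4 * (s - t)) ^ ((α - 1) / 2) * (4 * (δ / 4 * (s - t)) ^ (-1 : ℝ) * L) := by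
        gcongr
    _ = _ := by rw [← e4]; ring

end HeatSmoothing

section PowerIntegrals

open MeasureTheory Filter Topology

lemma intervalIntegrable_sub_rpow {p : ℝ} (hp : -1 < p) (t t' : ℝ) :
    IntervalIntegrable (fun s => (s - t) ^ p) volume t t' := by
  have := (intervalIntegral.intervalIntegrable_rpow' hp (a := 0) (b := t' - t)).comp_sub_right t
  simpa using this

lemma integral_sub_rpow {p : ℝ} (hp : -1 < p) (t t' : ℝ) :
    ∫ s in t..t', (s - t) ^ p = (t' - t) ^ (p + 1) / (p + 1) := by
  rw [intervalIntegral.integral_comp_sub_right (fun s => s ^ p) t, integral_rpow (Or.inl hp)]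
  simp [Real.zero_rpow (by linarith : p + 1 ≠ 0)]

lemma integral_far_rpow_le {p : ℝ} (hp : p < -1) {t t' c : ℝ} (hc : 0 < c) (hct : t + c ≤ t') :
    IntervalIntegrable (fun s => (s - t) ^ p) volume (t + c) t' ∧
      ∫ s in (t + c)..t', (s - t) ^ p ≤ c ^ (p + 1) / (-(p + 1)) := by
  have h0 : (0 : ℝ) ∉ uIcc (t + c - t) (t' - t) := by
    rw [uIcc_of_le (by linarith)]
    intro h
    linarith [h.1]
  constructor
  · have := (intervalIntegral.intervalIntegrable_rpow (μ := volume) (r := p) (Or.inr h0)).comp_sub_right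
      t
    rwa [sub_add_cancel, sub_add_cancel] at this
  · rw [intervalIntegral.integral_comp_sub_right (fun s => s ^ p) t,
      integral_rpow (Or.inr ⟨hp.ne, h0⟩), add_sub_cancel_left, div_neg, ← neg_div]
    rw [div_le_div_right_of_neg (by linarith)]
    have := Real.rpow_nonneg (by linarith : 0 ≤ t' - t) (p + 1)
    linarith

lemma abs_integral_le_of_rpow {p a : ℝ} (hp : -1 < p) {t t' : ℝ} (htt : t ≤ t') {φ : ℝ → ℝ}
    (h : ∀ s ∈ Ioc t t', |φ s| ≤ a * (s - t) ^ p) :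
    |∫ s in t..t', φ s| ≤ a * ((t' - t) ^ (p + 1) / (p + 1)) := by
  rw [← integral_sub_rpow hp, ← intervalIntegral.integral_const_mul, ← Real.norm_eq_abs]
  exact intervalIntegral.norm_integral_le_of_norm_le htt
    ((ae_of_all _ fun s hs => h s hs))
    ((intervalIntegrable_sub_rpow hp t t').const_mul a)

/-- Splitting a singular integral at parabolic distance `r`. -/
lemma abs_integral_le_split {α a b r : ℝ} (hα : 0 < α) (hα1 : α < 1) (hr : 0 < r) (ha : 0 ≤ a)
    (hb : 0 ≤ b) {t t' : ℝ} (htt : t ≤ t') {φ : ℝ → ℝ} (hφ : IntervalIntegrable φ volume t t')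
    (h1 : ∀ s ∈ Ioc t t', |φ s| ≤ a * (s - t) ^ (α / 2 - 1))
    (h2 : ∀ s ∈ Ioc t t', |φ s| ≤ b * r * (s - t) ^ ((α - 3) / 2)) :
    |∫ s in t..t', φ s| ≤ (a * (2 / α) + b * (2 / (1 - α))) * r ^ α := by
  have hr2 : (r ^ 2) ^ (α / 2 - 1 + 1) = r ^ α := by
    rw [← Real.rpow_natCast, ← Real.rpow_mul hr.le]
    congr 1
    push_cast
    ring
  have hb' : 0 ≤ b * (2 / (1 - α)) * r ^ α := by
    have : 0 < 1 - α := by linarith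
    positivity
  have near : ∀ t'', t ≤ t'' → t'' ≤ t' → t'' - t ≤ r ^ 2 →
      |∫ s in t..t'', φ s| ≤ a * (2 / α) * r ^ α := by
    intro t'' h3 h4 h5
    refine (abs_integral_le_of_rpow (by linarith) h3
      fun s hs => h1 s ⟨hs.1, hs.2.trans h4⟩).trans ?_
    rw [mul_assoc, ← hr2]
    refine mul_le_mul_of_nonneg_left ?_ ha
    rw [div_eq_mul_inv, mul_comm, show (α / 2 - 1 + 1)⁻¹ = 2 / α by
      rw [sub_add_cancel, inv_div]]
    exact mul_le_mul_of_nonneg_left (Real.rpow_le_rpow (by linarith) h5 (by linarith))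
      (by positivity)
  rw [add_mul]
  rcases le_total (t' - t) (r ^ 2) with h | h
  · linarith [near t' htt le_rfl h]
  · have hc : t + r ^ 2 ≤ t' := by linarith
    have hr20 : 0 < r ^ 2 := by positivity
    have hm : t + r ^ 2 ∈ uIcc t t' := by
      rw [uIcc_of_le htt]; constructor <;> linarith
    rw [← intervalIntegral.integral_add_adjacent_intervals
      (hφ.mono_set (uIcc_subset_uIcc left_mem_uIcc hm))
      (hφ.mono_set (uIcc_subset_uIcc hm right_mem_uIcc))]
    refine (abs_add_le _ _).trans (add_le_add (near _ (by linarith) hc (by linarith)) ?_)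
    have h3 := integral_far_rpow_le (p := (α - 3) / 2) (by linarith) hr20 hc
    have h4 := intervalIntegral.norm_integral_le_of_norm_le (f := φ)
      (g := fun s => b * r * (s - t) ^ ((α - 3) / 2)) hc
      (ae_of_all _ fun s hs => (h2 s ⟨by linarith [hs.1], hs.2⟩ : ‖φ s‖ ≤ _))
      (h3.1.const_mul (b * r))
    rw [intervalIntegral.integral_const_mul, Real.norm_eq_abs] at h4
    refine h4.trans ((mul_le_mul_of_nonneg_left h3.2 (by positivity)).trans (le_of_eq ?_))
    have e1 : (r ^ 2) ^ ((α - 3) / 2 + 1) = r ^ (α - 1) := by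
      rw [← Real.rpow_natCast, ← Real.rpow_mul hr.le]
      congr 1
      push_cast
      ring
    have e2 : r ^ α = r * r ^ (α - 1) := by
      rw [← Real.rpow_one_add' hr.le (by linarith)]
      congr 1
      ring
    rw [e1, e2, show -((α - 3) / 2 + 1) = (1 - α) / 2 by ring]
    field_simp

end PowerIntegrals

section Source

open MeasureTheory ProbabilityTheory Filter Topology

variable {D : ℕ} {δ κ α K : ℝ} {A : ℝ → Matrix (Fin D) (Fin D) ℝ}
  {μ : ℝ → ℝ → Measure (Fin D → ℝ)}

/-- Bounded, parabolically Hölder continuous source terms on `[0,T]`. -/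
structure HolderSource (α T M L : ℝ) (f : ℝ → (Fin D → ℝ) → ℝ) : Prop where
  space : ∀ s ∈ Icc (0 : ℝ) T, BH α M L (f s)
  time : ∀ s ∈ Icc (0 : ℝ) T, ∀ s' ∈ Icc (0 : ℝ) T, ∀ x, |f s x - f s' x| ≤ L * |s - s'| ^ (α / 2)

variable {T M L : ℝ} {f : ℝ → (Fin D → ℝ) → ℝ}

lemma HeatFamily.source_hol (h : HeatFamily δ κ α K A μ) (hα : 0 < α) (hT : T ≤ 1)
    (hf : HolderSource α T M L f) {t s s' : ℝ} (ht : 0 ≤ t) (hts : t ≤ s) (hs : s ≤ T)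
    (hts' : t ≤ s') (hs' : s' ≤ T) (x : Fin D → ℝ) :
    |avg (μ t s) (f s) x - avg (μ t s') (f s') x| ≤ L * (1 + κ) * |s - s'| ^ (α / 2) := by
  wlog hss : s ≤ s' generalizing s s'
  · rw [abs_sub_comm, abs_sub_comm s s']
    exact this hts' hs' hts hs (le_of_not_ge hss)
  have hs0 : 0 ≤ s := ht.trans hts
  have hs0' : 0 ≤ s' := ht.trans hts'
  have := h.prob t s
  have := h.prob s s'
  rw [h.avg_avg hα (hf.space s' ⟨hs0', hs'⟩) ht hts hss (hs'.trans hT)]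
  have h1 := hf.space s ⟨hs0, hs⟩
  have h2 := (hf.space s' ⟨hs0', hs'⟩).avg hα (μ s s')
  refine abs_avg_sub_avg_le (integrable_translate (h1.continuous hα) h1.bd x)
    (integrable_translate (h2.continuous hα) h2.bd x) fun z => ?_
  have h3 := hf.time s ⟨hs0, hs⟩ s' ⟨hs0', hs'⟩ (x + z)
  have h4 := h.abs_avg_sub_self_le hα (hf.space s' ⟨hs0', hs'⟩) hs0 hss (hs'.trans hT) (x + z)
  have e : |s - s'| = s' - s := by rw [abs_sub_comm, abs_of_nonneg (sub_nonneg.2 hss)]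
  rw [e] at h3 ⊢
  rw [abs_le] at *
  constructor <;> nlinarith

lemma HeatFamily.source_continuousOn (h : HeatFamily δ κ α K A μ) (hα : 0 < α) (hT : T ≤ 1)
    (hf : HolderSource α T M L f) {t : ℝ} (ht : 0 ≤ t) :
    ContinuousOn (fun p : ℝ × (Fin D → ℝ) => avg (μ t p.1) (f p.1) p.2) (Icc t T ×ˢ univ) := by
  rintro ⟨s, x⟩ ⟨hs, -⟩
  rw [ContinuousWithinAt, tendsto_iff_dist_tendsto_zero]
  have h1 : Continuous fun p : ℝ × (Fin D → ℝ) =>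
      L * (1 + κ) * |p.1 - s| ^ (α / 2) + L * en (p.2 - x) ^ α := by
    refine Continuous.add (continuous_const.mul ?_) (continuous_const.mul ?_)
    · exact (by fun_prop : Continuous fun p : ℝ × (Fin D → ℝ) => |p.1 - s|).rpow_const
        fun _ => Or.inr (by positivity)
    · exact (continuous_en.comp (by fun_prop)).rpow_const fun _ => Or.inr hα.le
  have h2 := (h1.tendsto (s, x)).mono_left (nhdsWithin_le_nhds (s := Icc t T ×ˢ univ))
  simp only [sub_self, abs_zero, en_zero, Real.zero_rpow hα.ne',
    Real.zero_rpow (by positivity : α / 2 ≠ 0), mul_zero, add_zero] at h2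
  refine squeeze_zero' (Eventually.of_forall fun _ => dist_nonneg) ?_ h2
  filter_upwards [self_mem_nhdsWithin] with p hp
  have := h.prob t s
  have h3 := h.source_hol hα hT hf ht hp.1.1 hp.1.2 hs.1 hs.2 p.2
  have h4 := ((hf.space s ⟨ht.trans hs.1, hs.2⟩).avg hα (μ t s)).hol p.2 x
  rw [Real.dist_eq]
  calc _ = |(avg (μ t p.1) (f p.1) p.2 - avg (μ t s) (f s) p.2) +
        (avg (μ t s) (f s) p.2 - avg (μ t s) (f s) x)| := by rw [sub_add_sub_cancel]
    _ ≤ _ := (abs_add_le _ _).trans (add_le_add h3 h4)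

lemma HeatFamily.source_intervalIntegrable (h : HeatFamily δ κ α K A μ) (hα : 0 < α) (hT : T ≤ 1)
    (hf : HolderSource α T M L f) {t a b : ℝ} (ht : 0 ≤ t) (hta : t ≤ a) (hab : a ≤ b)
    (hb : b ≤ T) (x : Fin D → ℝ) :
    IntervalIntegrable (fun s => avg (μ t s) (f s) x) volume a b := by
  refine ContinuousOn.intervalIntegrable ?_
  rw [uIcc_of_le hab]
  exact (h.source_continuousOn hα hT hf ht).comp (f := fun s => (s, x)) (by fun_prop)
    fun s hs => ⟨⟨hta.trans hs.1, hs.2.trans hb⟩, trivial⟩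

/-- The contribution of the source on `[t,t']`. -/
def duhamel (μ : ℝ → ℝ → Measure (Fin D → ℝ)) (f : ℝ → (Fin D → ℝ) → ℝ) (t t' : ℝ)
    (x : Fin D → ℝ) : ℝ := ∫ s in t..t', avg (μ t s) (f s) x

lemma HeatFamily.duhamel_chain (h : HeatFamily δ κ α K A μ) (hα : 0 < α) (hT : T ≤ 1)
    (hf : HolderSource α T M L f) {t t' : ℝ} (ht : 0 ≤ t) (htt : t ≤ t') (ht' : t' ≤ T) :
    duhamel μ f t T = fun x => avg (μ t t') (duhamel μ f t' T) x + duhamel μ f t t' x := by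
  ext x
  have ht0 := ht.trans htt
  have := h.prob t t'
  rw [duhamel, ← intervalIntegral.integral_add_adjacent_intervals
    (h.source_intervalIntegrable hα hT hf ht le_rfl htt ht' x)
    (h.source_intervalIntegrable hα hT hf ht htt ht' le_rfl x), add_comm]
  congr 1
  simp only [avg, duhamel]
  rw [intervalIntegral.integral_of_le ht']
  simp only [intervalIntegral.integral_of_le ht']
  have hc : ContinuousOn (fun p : (Fin D → ℝ) × ℝ => avg (μ t' p.2) (f p.2) (x + p.1))
      (univ ×ˢ Ioc t' T) :=
    (h.source_continuousOn hα hT hf ht0).comp (f := fun p : (Fin D → ℝ) × ℝ => (p.2, x + p.1))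
      (by fun_prop) fun p hp => ⟨Ioc_subset_Icc_self hp.2, trivial⟩
  have hm : AEStronglyMeasurable
      (fun p : (Fin D → ℝ) × ℝ => avg (μ t' p.2) (f p.2) (x + p.1))
      ((μ t t').prod (volume.restrict (Ioc t' T))) := by
    have := hc.aestronglyMeasurable (μ := (μ t t').prod volume)
      (MeasurableSet.univ.prod measurableSet_Ioc)
    rwa [← Measure.prod_restrict, Measure.restrict_univ] at this
  have h_int : Integrable (fun p : (Fin D → ℝ) × ℝ => avg (μ t' p.2) (f p.2) (x + p.1))
      ((μ t t').prod (volume.restrict (Ioc t' T))) := by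
    refine (integrable_const M).mono' hm ?_
    have h1 : ∀ᵐ p ∂(μ t t').prod (volume.restrict (Ioc t' T)), p.2 ∈ Ioc t' T :=
      Measure.quasiMeasurePreserving_snd.ae (ae_restrict_mem measurableSet_Ioc)
    filter_upwards [h1] with p hp
    have := h.prob t' p.2
    exact abs_avg_le (hf.space p.2 ⟨ht0.trans hp.1.le, hp.2⟩).bd _
  simp only [avg] at h_int
  rw [integral_integral_swap (f := fun z s => ∫ w, f s (x + z + w) ∂μ t' s) h_int]
  refine setIntegral_congr_fun measurableSet_Ioc fun s hs => ?_
  exact congrFun (h.avg_avg hα (hf.space s ⟨ht0.trans hs.1.le, hs.2⟩) ht htt hs.1.le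
    (hs.2.trans hT)) x

end Source

section DuhamelRegularity

open MeasureTheory ProbabilityTheory Filter Topology

variable {D : ℕ} {δ κ α K : ℝ} {A : ℝ → Matrix (Fin D) (Fin D) ℝ}
  {μ : ℝ → ℝ → Measure (Fin D → ℝ)} {T M L : ℝ} {f : ℝ → (Fin D → ℝ) → ℝ}

/-- Differentiation under an interval integral whose integrand is singular at `t`. -/
lemma intervalIntegral_C1 {t t' p a : ℝ} (hp : -1 < p) (htt : t ≤ t')
    {F : ℝ → (Fin D → ℝ) → ℝ} (h_int : ∀ x, IntervalIntegrable (fun s => F s x) volume t t')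
    (hC1 : ∀ s ∈ Ioc t t', ContDiff ℝ 1 (F s))
    (hbd : ∀ s ∈ Ioc t t', ∀ d x, |pd (F s) d x| ≤ a * (s - t) ^ p) :
    ContDiff ℝ 1 (fun x => ∫ s in t..t', F s x) ∧
      (∀ d, pd (fun x => ∫ s in t..t', F s x) d = fun x => ∫ s in t..t', pd (F s) d x) ∧
      ∀ d x, IntervalIntegrable (fun s => pd (F s) d x) volume t t' := by
  have h1 := integral_C1 (m := volume.restrict (Ioc t t')) (F := F)
    (B := fun s => a * (s - t) ^ p)
    ((intervalIntegrable_iff_integrableOn_Ioc_of_le htt).1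
      ((intervalIntegrable_sub_rpow hp t t').const_mul a))
    (fun x => (intervalIntegrable_iff_integrableOn_Ioc_of_le htt).1 (h_int x))
    ((ae_restrict_mem measurableSet_Ioc).mono hC1)
    ((ae_restrict_mem measurableSet_Ioc).mono hbd)
  simp only [intervalIntegral.integral_of_le htt]
  exact ⟨h1.1, fun d => funext (h1.2.1 d),
    fun d x => (intervalIntegrable_iff_integrableOn_Ioc_of_le htt).2 (h1.2.2 d x)⟩

lemma HeatFamily.duhamel_deriv (h : HeatFamily δ κ α K A μ) (hα : 0 < α) (hα1 : α < 1)
    (hδ : 0 < δ) (hT : T ≤ 1) (hf : HolderSource α T M L f) {t t' : ℝ} (ht : 0 ≤ t)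
    (htt : t ≤ t') (ht' : t' ≤ T) :
    ContDiff ℝ 2 (duhamel μ f t t') ∧
    (∀ d, pd (duhamel μ f t t') d = fun x => ∫ s in t..t', pd (avg (μ t s) (f s)) d x) ∧
    (∀ d e, pdd (duhamel μ f t t') d e =
      fun x => ∫ s in t..t', pdd (avg (μ t s) (f s)) d e x) ∧
    (∀ d x, IntervalIntegrable (fun s => pd (avg (μ t s) (f s)) d x) volume t t') ∧
    ∀ d e x, IntervalIntegrable (fun s => pdd (avg (μ t s) (f s)) d e x) volume t t' := by
  have hf' : ∀ s ∈ Ioc t t', BH α M L (f s) := fun s hs =>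
    hf.space s ⟨ht.trans hs.1.le, hs.2.trans ht'⟩
  have h1 := fun s (hs : s ∈ Ioc t t') => h.smoothing_C1 hα hα1.le hδ (hf' s hs) ht hs.1
    (hs.2.trans (ht'.trans hT))
  have h2 := fun s (hs : s ∈ Ioc t t') => h.smoothing_C2 hα hα1.le hδ (hf' s hs) ht hs.1
    (hs.2.trans (ht'.trans hT))
  have h3 := intervalIntegral_C1 (p := (α - 1) / 2) (a := 2 * δ ^ ((α - 1) / 2) * L)
    (by linarith) htt
    (fun x => h.source_intervalIntegrable hα hT hf ht le_rfl htt ht' x)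
    (fun s hs => (h1 s hs).1) fun s hs d x => (((h1 s hs).2 d).2 x).trans (le_of_eq (by
      rw [Real.mul_rpow hδ.le (sub_nonneg.2 hs.1.le)]; ring))
  have h4 := fun d => intervalIntegral_C1 (p := α / 2 - 1)
    (F := fun s => pd (avg (μ t s) (f s)) d) (a := 4 * (δ / 2) ^ (α / 2 - 1) * L)
    (by linarith) htt (h3.2.2 d) (fun s hs => contDiff_pd (h2 s hs).1 d)
    fun s hs e x => (((h2 s hs).2 e d).2 x).trans (le_of_eq (by
      rw [Real.mul_rpow (by positivity) (sub_nonneg.2 hs.1.le)]; ring))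
  refine ⟨contDiff_two_of_pd h3.1 fun d => ?_, h3.2.1, fun d e => ?_, h3.2.2, fun d e x =>
    (h4 e).2.2 d x⟩
  · have := (h4 d).1
    rw [← h3.2.1 d] at this
    exact this
  · have := (h4 e).2.1 d
    rw [← h3.2.1 e] at this
    exact this

/-- Constant in the spatial Hölder bound of the second derivatives of the Duhamel term. -/
def duhamelConst (D : ℕ) (δ α : ℝ) : ℝ :=
  8 * (δ / 2) ^ (α / 2 - 1) * (2 / α) + D * (8 * (δ / 4) ^ ((α - 3) / 2)) * (2 / (1 - α))

lemma HeatFamily.duhamel_bounds (h : HeatFamily δ κ α K A μ) (hα : 0 < α) (hα1 : α < 1)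
    (hδ : 0 < δ) (hT : T ≤ 1) (hf : HolderSource α T M L f) {t t' : ℝ} (ht : 0 ≤ t)
    (htt : t ≤ t') (ht' : t' ≤ T) :
    (∀ x, |duhamel μ f t t' x| ≤ (t' - t) * M) ∧
    (∀ d, BH α (4 * δ ^ (-1 / 2 : ℝ) * √(t' - t) * M) (4 * δ ^ (-1 / 2 : ℝ) * √(t' - t) * L)
      (pd (duhamel μ f t t') d)) ∧
    (∀ d x, |pd (duhamel μ f t t') d x| ≤
      2 * δ ^ ((α - 1) / 2) * (2 / (α + 1)) * L * (t' - t) ^ ((α + 1) / 2)) ∧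
    ∀ d e, BH α (4 * (δ / 2) ^ (α / 2 - 1) * (2 / α) * L * (t' - t) ^ (α / 2))
      (duhamelConst D δ α * L) (pdd (duhamel μ f t t') d e) := by
  obtain ⟨-, hp, hpp, ip, ipp⟩ := h.duhamel_deriv hα hα1 hδ hT hf ht htt ht'
  have hf' : ∀ s ∈ Ioc t t', BH α M L (f s) := fun s hs =>
    hf.space s ⟨ht.trans hs.1.le, hs.2.trans ht'⟩
  have hL : 0 ≤ L := (hf.space t ⟨ht, htt.trans ht'⟩).nonneg
  have h1 := fun s (hs : s ∈ Ioc t t') => h.smoothing_C1 hα hα1.le hδ (hf' s hs) ht hs.1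
    (hs.2.trans (ht'.trans hT))
  have h2 := fun s (hs : s ∈ Ioc t t') => h.smoothing_C2 hα hα1.le hδ (hf' s hs) ht hs.1
    (hs.2.trans (ht'.trans hT))
  have sqrt_int : ∀ {φ : ℝ → ℝ} {B : ℝ},
      (∀ s ∈ Ioc t t', |φ s| ≤ 2 * (δ * (s - t)) ^ (-1 / 2 : ℝ) * B) →
      |∫ s in t..t', φ s| ≤ 4 * δ ^ (-1 / 2 : ℝ) * √(t' - t) * B := by
    intro φ B hφ
    refine (abs_integral_le_of_rpow (p := -1 / 2) (a := 2 * δ ^ (-1 / 2 : ℝ) * B) (by norm_num)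
      htt fun s hs => (hφ s hs).trans (le_of_eq ?_)).trans (le_of_eq ?_)
    · rw [Real.mul_rpow hδ.le (sub_nonneg.2 hs.1.le)]; ring
    · rw [Real.sqrt_eq_rpow, show (-1 / 2 + 1 : ℝ) = 1 / 2 by norm_num]; ring
  refine ⟨fun x => ?_, fun d => ⟨by positivity, fun x => ?_, fun x y => ?_⟩, fun d x => ?_,
    fun d e => ⟨?_, fun x => ?_, fun x y => ?_⟩⟩
  · rw [duhamel, ← Real.norm_eq_abs]
    refine (intervalIntegral.norm_integral_le_of_norm_le_const (C := M) fun s hs => ?_).trans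
      (le_of_eq ?_)
    · rw [uIoc_of_le htt] at hs
      have := h.prob t s
      exact abs_avg_le (hf' s hs).bd x
    · rw [abs_of_nonneg (sub_nonneg.2 htt)]; ring
  · rw [hp d]
    exact sqrt_int fun s hs => ((h1 s hs).2 d).1.bd x
  · rw [hp d, ← intervalIntegral.integral_sub (ip d x) (ip d y), mul_assoc]
    refine sqrt_int fun s hs => (((h1 s hs).2 d).1.hol x y).trans (le_of_eq ?_)
    ring
  · rw [hp d]
    refine (abs_integral_le_of_rpow (p := (α - 1) / 2) (a := 2 * δ ^ ((α - 1) / 2) * L)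
      (by linarith) htt fun s hs => (((h1 s hs).2 d).2 x).trans (le_of_eq ?_)).trans
      (le_of_eq ?_)
    · rw [Real.mul_rpow hδ.le (sub_nonneg.2 hs.1.le)]; ring
    · rw [show (α - 1) / 2 + 1 = (α + 1) / 2 by ring]
      field_simp
  · have : 0 < 1 - α := by linarith
    rw [duhamelConst]
    positivity
  · rw [hpp d e]
    refine (abs_integral_le_of_rpow (p := α / 2 - 1) (a := 4 * (δ / 2) ^ (α / 2 - 1) * L)
      (by linarith) htt fun s hs => (((h2 s hs).2 d e).2 x).trans (le_of_eq ?_)).trans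
      (le_of_eq ?_)
    · rw [Real.mul_rpow (by positivity) (sub_nonneg.2 hs.1.le)]; ring
    · rw [sub_add_cancel]
      field_simp
  · rcases eq_or_ne x y with rfl | hxy
    · simp [en_zero, Real.zero_rpow hα.ne']
    rw [hpp d e, ← intervalIntegral.integral_sub (ipp d e x) (ipp d e y)]
    refine (abs_integral_le_split (r := en (x - y)) (a := 8 * (δ / 2) ^ (α / 2 - 1) * L)
      (b := D * (8 * (δ / 4) ^ ((α - 3) / 2)) * L) hα hα1 (en_pos_of_ne hxy)
      (by positivity) (by positivity) htt ((ipp d e x).sub (ipp d e y)) (fun s hs => ?_)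
      (fun s hs => ?_)).trans (le_of_eq ?_)
    · refine (abs_sub _ _).trans ((add_le_add (((h2 s hs).2 d e).2 x)
        (((h2 s hs).2 d e).2 y)).trans (le_of_eq ?_))
      rw [Real.mul_rpow (by positivity) (sub_nonneg.2 hs.1.le)]; ring
    · refine (h.pdd_lipschitz hα hα1.le hδ (hf' s hs) ht hs.1 (hs.2.trans (ht'.trans hT))
        d e x y).trans (le_of_eq ?_)
      rw [Real.mul_rpow (by positivity) (sub_nonneg.2 hs.1.le)]; ring
    · rw [duhamelConst]; ring

lemma HeatFamily.duhamel_self_sub (h : HeatFamily δ κ α K A μ) (hα : 0 < α) (hT : T ≤ 1)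
    (hf : HolderSource α T M L f) {t t' : ℝ} (ht : 0 ≤ t) (htt : t ≤ t') (ht' : t' ≤ T)
    (hκ : 0 ≤ κ) (x : Fin D → ℝ) :
    |duhamel μ f t t' x - (t' - t) * f t' x| ≤ L * (1 + 2 * κ) * (t' - t) ^ (1 + α / 2) := by
  have hL : 0 ≤ L := (hf.space t ⟨ht, htt.trans ht'⟩).nonneg
  have e : (t' - t) * f t' x = ∫ _s in t..t', f t' x := by simp
  have hs0 := sub_nonneg.2 htt
  rw [e, duhamel, ← intervalIntegral.integral_sub
    (h.source_intervalIntegrable hα hT hf ht le_rfl htt ht' x) (by simp), ← Real.norm_eq_abs]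
  refine (intervalIntegral.norm_integral_le_of_norm_le_const
    (C := L * (1 + 2 * κ) * (t' - t) ^ (α / 2)) fun s hs => ?_).trans (le_of_eq ?_)
  · rw [uIoc_of_le htt] at hs
    have h1 := h.source_hol hα hT hf ht hs.1.le (hs.2.trans ht') htt ht' x
    have h2 := h.abs_avg_sub_self_le hα (hf.space t' ⟨ht.trans htt, ht'⟩) ht htt (ht'.trans hT) x
    have h3 : |s - t'| ^ (α / 2) ≤ (t' - t) ^ (α / 2) := by
      refine Real.rpow_le_rpow (abs_nonneg _) ?_ (by positivity)
      rw [abs_sub_comm, abs_of_nonneg (by linarith [hs.2])]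
      linarith [hs.1]
    have h4 := mul_le_mul_of_nonneg_left h3 (mul_nonneg hL (by linarith : 0 ≤ 1 + κ))
    calc _ = |(avg (μ t s) (f s) x - avg (μ t t') (f t') x) +
        (avg (μ t t') (f t') x - f t' x)| := by rw [sub_add_sub_cancel, Real.norm_eq_abs]
      _ ≤ _ := (abs_add_le _ _).trans (add_le_add (h1.trans h4) h2)
      _ = _ := by ring
  · rw [abs_of_nonneg hs0, Real.rpow_add' hs0 (by positivity), Real.rpow_one]
    ring

end DuhamelRegularity

section ParabolicHolder

open MeasureTheory Filter Topology

variable {D : ℕ} {α T M M' N N' H H' L L' : ℝ}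

lemma BH.add {F G : (Fin D → ℝ) → ℝ} (hF : BH α M L F) (hG : BH α M' L' G) :
    BH α (M + M') (L + L') (fun x => F x + G x) := by
  refine ⟨add_nonneg hF.nonneg hG.nonneg, fun x => ?_, fun x y => ?_⟩
  · exact (abs_add_le _ _).trans (add_le_add (hF.bd x) (hG.bd x))
  · rw [add_sub_add_comm, add_mul]
    exact (abs_add_le _ _).trans (add_le_add (hF.hol x y) (hG.hol x y))

lemma pd_add {F G : (Fin D → ℝ) → ℝ} (hF : ContDiff ℝ 1 F) (hG : ContDiff ℝ 1 G) (d : Fin D) :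
    pd (fun x => F x + G x) d = fun x => pd F d x + pd G d x := by
  ext x
  rw [pd, fderiv_fun_add (hF.differentiable one_ne_zero x) (hG.differentiable one_ne_zero x)]
  rfl

lemma pdd_add {F G : (Fin D → ℝ) → ℝ} (hF : ContDiff ℝ 2 F) (hG : ContDiff ℝ 2 G)
    (d e : Fin D) : pdd (fun x => F x + G x) d e = fun x => pdd F d e x + pdd G d e x := by
  have h1 : pdd (fun x => F x + G x) d e = pd (pd (fun x => F x + G x) e) d := rfl
  rw [h1, pd_add (hF.of_le (by norm_num)) (hG.of_le (by norm_num)),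
    pd_add (contDiff_pd hF e) (contDiff_pd hG e)]
  rfl

lemma BoundedC2.add {F G : (Fin D → ℝ) → ℝ} (hF : BoundedC2 α M N H F)
    (hG : BoundedC2 α M' N' H' G) :
    BoundedC2 α (M + M') (N + N') (H + H') (fun x => F x + G x) := by
  refine ⟨hF.contDiff.add hG.contDiff, fun x => ?_, fun d x => ?_, fun d e => ?_⟩
  · exact (abs_add_le _ _).trans (add_le_add (hF.bd x) (hG.bd x))
  · rw [pd_add hF.contDiff_one hG.contDiff_one]
    exact (abs_add_le _ _).trans (add_le_add (hF.pd_bd d x) (hG.pd_bd d x))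
  · rw [pdd_add hF.contDiff hG.contDiff]
    exact (hF.pdd_hol d e).add (hG.pdd_hol d e)

lemma BoundedC2.bh (hα : 0 ≤ α) (hα1 : α ≤ 1) {F : (Fin D → ℝ) → ℝ} (hF : BoundedC2 α M N H F)
    (hN : 0 ≤ N) : BH α M (2 * M + D * N) F :=
  hol_of_bd_lip hα hα1 (by positivity) hF.bd (lip_of_pd_bd hF.contDiff_one hF.pd_bd)

lemma BoundedC2.pd_bh (hα : 0 ≤ α) (hα1 : α ≤ 1) {F : (Fin D → ℝ) → ℝ}
    (hF : BoundedC2 α M N H F) (hN : 0 ≤ N) (d : Fin D) : BH α N (2 * N + D * N) (pd F d) :=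
  hol_of_bd_lip hα hα1 (by positivity) (hF.pd_bd d)
    (lip_of_pd_bd (contDiff_pd hF.contDiff d) fun e => (hF.pdd_hol e d).bd)

variable {f f' : ℝ → (Fin D → ℝ) → ℝ}

lemma HolderSource.hol (hf : HolderSource α T M L f) {t s : ℝ} (ht : t ∈ Icc 0 T)
    (hs : s ∈ Icc 0 T) (x y : Fin D → ℝ) :
    |f t x - f s y| ≤ L * (|t - s| ^ (α / 2) + en (x - y) ^ α) := by
  rw [← sub_add_sub_cancel (f t x) (f s x), mul_add]
  exact (abs_add_le _ _).trans (add_le_add (hf.time t ht s hs x) ((hf.space s hs).hol x y))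

lemma HolderSource.continuousOn (hf : HolderSource α T M L f) (hα : 0 < α) :
    ContinuousOn (fun p : ℝ × (Fin D → ℝ) => f p.1 p.2) (Icc 0 T ×ˢ univ) := by
  rintro ⟨s, x⟩ ⟨hs, -⟩
  rw [ContinuousWithinAt, tendsto_iff_dist_tendsto_zero]
  have h1 : Continuous fun p : ℝ × (Fin D → ℝ) =>
      L * (|p.1 - s| ^ (α / 2) + en (p.2 - x) ^ α) := by
    refine continuous_const.mul (Continuous.add ?_ ?_)
    · exact (by fun_prop : Continuous fun p : ℝ × (Fin D → ℝ) => |p.1 - s|).rpow_const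
        fun _ => Or.inr (by positivity)
    · exact (continuous_en.comp (by fun_prop)).rpow_const fun _ => Or.inr hα.le
  have h2 := (h1.tendsto (s, x)).mono_left (nhdsWithin_le_nhds (s := Icc 0 T ×ˢ univ))
  simp only [sub_self, abs_zero, en_zero, Real.zero_rpow hα.ne',
    Real.zero_rpow (by positivity : α / 2 ≠ 0), mul_zero, add_zero] at h2
  refine squeeze_zero' (Eventually.of_forall fun _ => dist_nonneg) ?_ h2
  filter_upwards [self_mem_nhdsWithin] with p hp
  exact hf.hol hp.1 hs p.2 x

lemma HolderSource.add (hf : HolderSource α T M L f) (hf' : HolderSource α T M' L' f') :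
    HolderSource α T (M + M') (L + L') (fun t x => f t x + f' t x) := by
  refine ⟨fun t ht => (hf.space t ht).add (hf'.space t ht), fun t ht s hs x => ?_⟩
  rw [add_sub_add_comm, add_mul]
  exact (abs_add_le _ _).trans (add_le_add (hf.time t ht s hs x) (hf'.time t ht s hs x))

lemma abs_mul_sub_mul_le {a b a' b' P Q ε η : ℝ} (ha : |a| ≤ P) (hb : |b'| ≤ Q)
    (h1 : |b - b'| ≤ ε) (h2 : |a - a'| ≤ η) : |a * b - a' * b'| ≤ P * ε + Q * η := by
  rw [show a * b - a' * b' = a * (b - b') + b' * (a - a') by ring]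
  refine (abs_add_le _ _).trans ?_
  rw [abs_mul, abs_mul]
  have := abs_nonneg a
  have := abs_nonneg b'
  gcongr
  · exact (abs_nonneg _).trans ha
  · exact (abs_nonneg _).trans hb

lemma HolderSource.mul (hf : HolderSource α T M L f) (hf' : HolderSource α T M' L' f')
    (hM : 0 ≤ M) (hM' : 0 ≤ M') :
    ∃ L'', HolderSource α T (M * M') L'' (fun t x => f t x * f' t x) := by
  by_cases hT : (Icc (0 : ℝ) T).Nonempty
  swap
  · exact ⟨0, fun t ht => (hT ⟨t, ht⟩).elim, fun t ht => (hT ⟨t, ht⟩).elim⟩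
  obtain ⟨t₀, ht₀⟩ := hT
  have hL := (hf.space t₀ ht₀).nonneg
  have hL' := (hf'.space t₀ ht₀).nonneg
  refine ⟨M * L' + M' * L, fun t ht => ⟨by positivity, fun x => ?_, fun x y => ?_⟩,
    fun t ht s hs x => ?_⟩
  · rw [abs_mul]
    exact mul_le_mul ((hf.space t ht).bd x) ((hf'.space t ht).bd x) (abs_nonneg _) hM
  · refine (abs_mul_sub_mul_le ((hf.space t ht).bd x) ((hf'.space t ht).bd y)
      ((hf'.space t ht).hol x y) ((hf.space t ht).hol x y)).trans (le_of_eq (by ring))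
  · refine (abs_mul_sub_mul_le ((hf.space t ht).bd x) ((hf'.space s hs).bd x)
      (hf'.time t ht s hs x) (hf.time t ht s hs x)).trans (le_of_eq (by ring))

lemma HolderSource.sum {ι : Type*} (s : Finset ι) {F : ι → ℝ → (Fin D → ℝ) → ℝ}
    (hF : ∀ i ∈ s, ∃ M L, 0 ≤ M ∧ HolderSource α T M L (F i)) :
    ∃ M L, 0 ≤ M ∧ HolderSource α T M L (fun t x => ∑ i ∈ s, F i t x) := by
  classical
  induction s using Finset.induction_on with
  | empty =>
    exact ⟨0, 0, le_rfl, fun t _ => ⟨le_rfl, by simp, by simp⟩, by simp⟩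
  | insert i s hi ih =>
    obtain ⟨M, L, h0, h1⟩ := hF i (Finset.mem_insert_self i s)
    obtain ⟨M', L', h0', h1'⟩ := ih fun j hj => hF j (Finset.mem_insert_of_mem hj)
    simp only [Finset.sum_insert hi]
    exact ⟨_, _, add_nonneg h0 h0', h1.add h1'⟩

lemma HolderSource.congr (hf : HolderSource α T M L f) (h : ∀ t ∈ Icc 0 T, f' t = f t) :
    HolderSource α T M L f' := by
  refine ⟨fun t ht => by rw [h t ht]; exact hf.space t ht, fun t ht s hs x => ?_⟩
  rw [h t ht, h s hs]
  exact hf.time t ht s hs x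

lemma HolderSource.neg (hf : HolderSource α T M L f) :
    HolderSource α T M L (fun t x => -f t x) := by
  refine ⟨fun t ht => ⟨(hf.space t ht).nonneg, fun x => ?_, fun x y => ?_⟩,
    fun t ht s hs x => ?_⟩
  · rw [abs_neg]; exact (hf.space t ht).bd x
  · rw [neg_sub_neg, abs_sub_comm]; exact (hf.space t ht).hol x y
  · rw [neg_sub_neg, abs_sub_comm]; exact hf.time t ht s hs x

lemma HolderSource.psup_le (hf : HolderSource α T M L f) : ∀ r ∈ psupSet T f, r ≤ M := by
  rintro r ⟨t, x, ht, rfl⟩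
  exact (hf.space t ht).bd x

lemma parabolic_pos {t s : ℝ} {x y : Fin D → ℝ} (h : ((t, x) : ℝ × (Fin D → ℝ)) ≠ (s, y)) :
    0 < √|t - s| + en (x - y) := by
  rcases eq_or_ne x y with rfl | hxy
  · have : t ≠ s := fun e => h (by rw [e])
    have : 0 < √|t - s| := Real.sqrt_pos.2 (abs_pos.2 (sub_ne_zero.2 this))
    have := en_nonneg (x - x)
    linarith
  · have := en_pos_of_ne hxy
    have := Real.sqrt_nonneg |t - s|
    linarith

lemma sqrt_rpow_eq {a : ℝ} (ha : 0 ≤ a) : √a ^ α = a ^ (α / 2) := by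
  rw [Real.sqrt_eq_rpow, ← Real.rpow_mul ha]
  congr 1
  ring

lemma HolderSource.psemi_le (hf : HolderSource α T M L f) (hα : 0 < α) :
    ∀ r ∈ psemiSet T α f, r ≤ 2 * L := by
  rintro r ⟨t, x, s, y, ht, hs, hne, rfl⟩
  have hp := parabolic_pos hne
  rw [div_le_iff₀ (Real.rpow_pos_of_pos hp α), two_mul, add_mul]
  refine (hf.hol ht hs x y).trans ?_
  rw [mul_add, ← sqrt_rpow_eq (abs_nonneg _)]
  have hL := (hf.space t ht).nonneg
  have h1 := Real.sqrt_nonneg |t - s|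
  have h2 := en_nonneg (x - y)
  gcongr <;> linarith

lemma HolderSource.of_sSup (h1 : BddAbove (psupSet T f))
    (h2 : BddAbove (psemiSet T α f)) :
    HolderSource α T (sSup (psupSet T f)) (sSup (psemiSet T α f)) f := by
  have hnn : 0 ≤ sSup (psemiSet T α f) := by
    refine Real.sSup_nonneg ?_
    rintro r ⟨t, x, s, y, ht, hs, hne, rfl⟩
    have := parabolic_pos hne
    positivity
  have key : ∀ t ∈ Icc 0 T, ∀ s ∈ Icc 0 T, ∀ x y,
      |f t x - f s y| ≤ sSup (psemiSet T α f) * (√|t - s| + en (x - y)) ^ α := by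
    intro t ht s hs x y
    by_cases hne : ((t, x) : ℝ × (Fin D → ℝ)) = (s, y)
    · obtain ⟨rfl, rfl⟩ := Prod.mk.inj hne
      rw [sub_self, abs_zero]
      have := en_nonneg (x - x)
      positivity
    · rw [← div_le_iff₀ (Real.rpow_pos_of_pos (parabolic_pos hne) α)]
      exact le_csSup h2 ⟨t, x, s, y, ht, hs, hne, rfl⟩
  refine ⟨fun t ht => ⟨hnn, fun x => le_csSup h1 ⟨t, x, ht, rfl⟩, fun x y => ?_⟩,
    fun t ht s hs x => ?_⟩
  · simpa using key t ht t ht x y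
  · simpa [en_zero, sqrt_rpow_eq] using key t ht s hs x x

lemma BH.of_sSup {F : (Fin D → ℝ) → ℝ} (h1 : BddAbove (sup0Set F))
    (h2 : BddAbove (hsemiSet α F)) : BH α (sSup (sup0Set F)) (sSup (hsemiSet α F)) F := by
  have hnn : 0 ≤ sSup (hsemiSet α F) := by
    refine Real.sSup_nonneg ?_
    rintro r ⟨x, y, hne, rfl⟩
    have := en_nonneg (x - y)
    positivity
  refine ⟨hnn, fun x => le_csSup h1 ⟨x, rfl⟩, fun x y => ?_⟩
  rcases eq_or_ne x y with rfl | hne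
  · rw [sub_self, abs_zero]
    have := en_nonneg (x - x)
    positivity
  · rw [← div_le_iff₀ (Real.rpow_pos_of_pos (en_pos_of_ne hne) α)]
    exact le_csSup h2 ⟨x, y, hne, rfl⟩

lemma BH.bddAbove {F : (Fin D → ℝ) → ℝ} (h : BH α M L F) : BddAbove (hsemiSet α F) := by
  refine ⟨L, ?_⟩
  rintro r ⟨x, y, hne, rfl⟩
  rw [div_le_iff₀ (Real.rpow_pos_of_pos (en_pos_of_ne hne) α)]
  exact h.hol x y

/-- A one-sided expansion with Hölder continuous coefficient gives a derivative. -/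
lemma hasDerivWithinAt_of_expansion {φ w : ℝ → ℝ} {B β : ℝ} (hβ : 0 < β)
    (h1 : ∀ t ∈ Icc 0 T, ∀ t' ∈ Icc 0 T, t ≤ t' →
      |φ t - φ t' - (t' - t) * w t'| ≤ B * (t' - t) ^ (1 + β))
    (h2 : ∀ t ∈ Icc 0 T, ∀ t' ∈ Icc 0 T, |w t - w t'| ≤ B * |t - t'| ^ β) {t : ℝ}
    (ht : t ∈ Icc 0 T) : HasDerivWithinAt φ (-w t) (Icc 0 T) t := by
  have h3 : ∀ s ∈ Icc 0 T, |φ s - φ t - (s - t) * (-w t)| ≤ 2 * B * |s - t| ^ β * |s - t| := by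
    intro s hs
    have hsplit : ∀ {a : ℝ}, 0 ≤ a → a ^ (1 + β) = a ^ β * a := fun ha => by
      rw [add_comm, Real.rpow_add' ha (by positivity), Real.rpow_one]
    rcases le_total s t with hst | hst
    · have h4 := h1 s hs t ht hst
      rw [hsplit (sub_nonneg.2 hst)] at h4
      rw [abs_sub_comm s t, abs_of_nonneg (sub_nonneg.2 hst)]
      have e : φ s - φ t - (s - t) * (-w t) = φ s - φ t - (t - s) * w t := by ring
      rw [e]
      have := (abs_nonneg _).trans h4
      linarith
    · have h4 := h1 t ht s hs hst
      have h5 := h2 s hs t ht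
      have h6 := sub_nonneg.2 hst
      rw [hsplit h6] at h4
      rw [abs_of_nonneg h6] at h5 ⊢
      have e : φ s - φ t - (s - t) * (-w t) =
          -(φ t - φ s - (s - t) * w s) - (s - t) * (w s - w t) := by ring
      rw [e]
      refine (abs_sub _ _).trans ?_
      rw [abs_neg, abs_mul, abs_of_nonneg h6]
      have := mul_le_mul_of_nonneg_left h5 h6
      linarith
  rw [hasDerivWithinAt_iff_isLittleO, Asymptotics.isLittleO_iff]
  intro c hc
  have h4 : Continuous fun s : ℝ => 2 * B * |s - t| ^ β :=
    continuous_const.mul ((by fun_prop : Continuous fun s : ℝ => |s - t|).rpow_const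
      fun _ => Or.inr hβ.le)
  have h5 : ∀ᶠ s in 𝓝[Icc 0 T] t, 2 * B * |s - t| ^ β < c := by
    refine (h4.tendsto t).mono_left nhdsWithin_le_nhds |>.eventually_lt_const ?_
    simpa [Real.zero_rpow hβ.ne'] using hc
  filter_upwards [h5, self_mem_nhdsWithin] with s hs hs'
  rw [Real.norm_eq_abs, Real.norm_eq_abs, smul_eq_mul]
  exact (h3 s hs').trans (mul_le_mul_of_nonneg_right hs.le (abs_nonneg _))

end ParabolicHolder

section HeatSolution

open MeasureTheory ProbabilityTheory Filter Topology

variable {D : ℕ} {δ δ' κ α K MA : ℝ} {A : ℝ → Matrix (Fin D) (Fin D) ℝ}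
  {μ : ℝ → ℝ → Measure (Fin D → ℝ)} {T M L : ℝ} {f : ℝ → (Fin D → ℝ) → ℝ}
  {Mg Ng Hg : ℝ} {g : (Fin D → ℝ) → ℝ}

/-- Duhamel's formula for the backward heat equation. -/
def heatSol (μ : ℝ → ℝ → Measure (Fin D → ℝ)) (T : ℝ) (f : ℝ → (Fin D → ℝ) → ℝ)
    (g : (Fin D → ℝ) → ℝ) (t : ℝ) (x : Fin D → ℝ) : ℝ :=
  avg (μ t T) g x + duhamel μ f t T x

lemma avg_add {μ : Measure (Fin D → ℝ)} [IsProbabilityMeasure μ] {F G : (Fin D → ℝ) → ℝ}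
    (hF : Continuous F) (hG : Continuous G) {M M' : ℝ} (hM : ∀ x, |F x| ≤ M)
    (hM' : ∀ x, |G x| ≤ M') (x : Fin D → ℝ) :
    avg μ (fun x => F x + G x) x = avg μ F x + avg μ G x :=
  integral_add (integrable_translate hF hM x) (integrable_translate hG hM' x)

/-- Sup bound of first and second derivatives of the Duhamel term. -/
def duhamelSup (δ α M L : ℝ) : ℝ :=
  4 * δ ^ (-1 / 2 : ℝ) * M + 4 * (δ / 2) ^ (α / 2 - 1) * (2 / α) * L

lemma HeatFamily.duhamel_boundedC2 (h : HeatFamily δ κ α K A μ) (hα : 0 < α) (hα1 : α < 1)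
    (hδ : 0 < δ) (hT : T ≤ 1) (hf : HolderSource α T M L f) {t t' : ℝ} (ht : 0 ≤ t)
    (htt : t ≤ t') (ht' : t' ≤ T) :
    BoundedC2 α M (duhamelSup δ α M L) (duhamelConst D δ α * L) (duhamel μ f t t') := by
  obtain ⟨h1, h2, -, h4⟩ := h.duhamel_bounds hα hα1 hδ hT hf ht htt ht'
  have hM : 0 ≤ M := (hf.space t ⟨ht, htt.trans ht'⟩).M_nonneg
  have hL : 0 ≤ L := (hf.space t ⟨ht, htt.trans ht'⟩).nonneg
  have ht1 : t' - t ≤ 1 := by linarith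
  have ht0 : 0 ≤ t' - t := sub_nonneg.2 htt
  refine ⟨(h.duhamel_deriv hα hα1 hδ hT hf ht htt ht').1, fun x => ?_, fun d x => ?_,
    fun d e => (h4 d e).mono ?_ le_rfl⟩
  · exact (h1 x).trans (mul_le_of_le_one_left hM ht1)
  · refine ((h2 d).bd x).trans ?_
    have : √(t' - t) ≤ 1 := Real.sqrt_le_one.2 ht1
    calc _ ≤ 4 * δ ^ (-1 / 2 : ℝ) * 1 * M + 0 := by rw [add_zero]; gcongr
      _ ≤ _ := by
        rw [duhamelSup, mul_one]
        gcongr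
        positivity
  · have : (t' - t) ^ (α / 2) ≤ 1 := Real.rpow_le_one ht0 ht1 (by positivity)
    calc _ ≤ 0 + 4 * (δ / 2) ^ (α / 2 - 1) * (2 / α) * L * 1 := by rw [zero_add]; gcongr
      _ ≤ _ := by
        rw [duhamelSup, mul_one]
        gcongr
        positivity

lemma HeatFamily.heatSol_boundedC2 (h : HeatFamily δ κ α K A μ) (hα : 0 < α) (hα1 : α < 1)
    (hδ : 0 < δ) (hT : T ≤ 1) (hf : HolderSource α T M L f) (hg : BoundedC2 α Mg Ng Hg g)
    {t : ℝ} (ht : t ∈ Icc 0 T) :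
    BoundedC2 α (Mg + M) (Ng + duhamelSup δ α M L) (Hg + duhamelConst D δ α * L)
      (heatSol μ T f g t) := by
  have := h.prob t T
  exact (avg_C2 hα hg (μ t T)).1.add (h.duhamel_boundedC2 hα hα1 hδ hT hf ht.1 ht.2 le_rfl)

lemma HeatFamily.heatSol_chain (h : HeatFamily δ κ α K A μ) (hα : 0 < α) (hα1 : α < 1)
    (hδ : 0 < δ) (hT : T ≤ 1) (hf : HolderSource α T M L f) (hg : BoundedC2 α Mg Ng Hg g)
    (hNg : 0 ≤ Ng) {t t' : ℝ} (ht : 0 ≤ t) (htt : t ≤ t') (ht' : t' ≤ T) :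
    heatSol μ T f g t =
      fun x => avg (μ t t') (heatSol μ T f g t') x + duhamel μ f t t' x := by
  have := h.prob t t'
  have := h.prob t' T
  ext x
  have h1 := (avg_C2 hα hg (μ t' T)).1
  have h2 := h.duhamel_boundedC2 hα hα1 hδ hT hf (ht.trans htt) ht' le_rfl
  have h3 := avg_add (μ := μ t t') h1.contDiff.continuous h2.contDiff.continuous h1.bd h2.bd x
  rw [heatSol, h.avg_avg hα (hg.bh hα.le hα1.le hNg) ht htt ht' hT,
    h.duhamel_chain hα hT hf ht htt ht']
  rw [show heatSol μ T f g t' =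
    fun x => avg (μ t' T) g x + duhamel μ f t' T x from rfl, h3]
  ring

lemma HeatFamily.heatSol_chain_pd (h : HeatFamily δ κ α K A μ) (hα : 0 < α) (hα1 : α < 1)
    (hδ : 0 < δ) (hT : T ≤ 1) (hf : HolderSource α T M L f) (hg : BoundedC2 α Mg Ng Hg g)
    (hNg : 0 ≤ Ng) {t t' : ℝ} (ht : 0 ≤ t) (htt : t ≤ t') (ht' : t' ≤ T) :
    (∀ d, pd (heatSol μ T f g t) d = fun x =>
      avg (μ t t') (pd (heatSol μ T f g t') d) x + pd (duhamel μ f t t') d x) ∧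
    ∀ d e, pdd (heatSol μ T f g t) d e = fun x =>
      avg (μ t t') (pdd (heatSol μ T f g t') d e) x + pdd (duhamel μ f t t') d e x := by
  have := h.prob t t'
  have h1 := avg_C2 hα (h.heatSol_boundedC2 hα hα1 hδ hT hf hg ⟨ht.trans htt, ht'⟩) (μ t t')
  have h2 := h.duhamel_boundedC2 hα hα1 hδ hT hf ht htt ht'
  rw [h.heatSol_chain hα hα1 hδ hT hf hg hNg ht htt ht']
  refine ⟨fun d => ?_, fun d e => ?_⟩
  · rw [pd_add h1.1.contDiff_one h2.contDiff_one, h1.2.1 d]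
  · rw [pdd_add h1.1.contDiff h2.contDiff, h1.2.2 d e]

lemma HeatFamily.heatSol_final (h : HeatFamily δ κ α K A μ) (hα : 0 < α) (hα1 : α < 1)
    (hT : T ≤ 1) (hT0 : 0 ≤ T) (hg : BoundedC2 α Mg Ng Hg g) (hNg : 0 ≤ Ng) (x : Fin D → ℝ) :
    heatSol μ T f g T x = g x := by
  have h1 := h.abs_avg_sub_self_le hα (hg.bh hα.le hα1.le hNg) hT0 le_rfl hT x
  rw [sub_self, Real.zero_rpow (by positivity), mul_zero] at h1
  have h2 := sub_eq_zero.1 (abs_nonpos_iff.1 h1)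
  simp [heatSol, duhamel, h2]

/-- Hölder continuity in time of the sum of a heat average and a small remainder. -/
lemma holderSource_of_chain (h : HeatFamily δ κ α K A μ) (hα : 0 < α) (hT : T ≤ 1) (hκ : 0 ≤ κ)
    {P : ℝ → (Fin D → ℝ) → ℝ} {R : ℝ → ℝ → (Fin D → ℝ) → ℝ} {B : ℝ} (hB : 0 ≤ B)
    (hP : ∀ t ∈ Icc 0 T, BH α M L (P t))
    (hR : ∀ t t', 0 ≤ t → t ≤ t' → t' ≤ T → ∀ x, |R t t' x| ≤ B * (t' - t) ^ (α / 2))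
    (hc : ∀ t t', 0 ≤ t → t ≤ t' → t' ≤ T → P t = fun x => avg (μ t t') (P t') x + R t t' x) :
    HolderSource α T M ((1 + κ) * L + B) P := by
  refine ⟨fun t ht => (hP t ht).mono le_rfl ?_, fun t ht s hs x => ?_⟩
  · have := (hP t ht).nonneg
    nlinarith [mul_nonneg hκ this]
  · wlog hts : t ≤ s generalizing t s
    · rw [abs_sub_comm, abs_sub_comm t]
      exact this s hs t ht (le_of_not_ge hts)
    have h1 := h.abs_avg_sub_self_le hα (hP s hs) ht.1 hts (hs.2.trans hT) x
    have h2 := hR t s ht.1 hts hs.2 x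
    have hL := (hP s hs).nonneg
    have h0 := sub_nonneg.2 hts
    rw [hc t s ht.1 hts hs.2, abs_sub_comm t s, abs_of_nonneg h0]
    calc _ = |(avg (μ t s) (P s) x - P s x) + R t s x| := by congr 1; ring
      _ ≤ _ := (abs_add_le _ _).trans (add_le_add h1 h2)
      _ ≤ L * κ * (s - t) ^ (α / 2) + B * (s - t) ^ (α / 2) + L * (s - t) ^ (α / 2) := by
        have : 0 ≤ L * (s - t) ^ (α / 2) := by positivity
        linarith
      _ = _ := by ring

lemma HeatFamily.heatSol_holder (h : HeatFamily δ κ α K A μ) (hα : 0 < α) (hα1 : α < 1)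
    (hδ : 0 < δ) (hT : T ≤ 1) (hκ : 0 ≤ κ) (hf : HolderSource α T M L f)
    (hg : BoundedC2 α Mg Ng Hg g) (hNg : 0 ≤ Ng) :
    (∃ L', HolderSource α T (Mg + M) L' (heatSol μ T f g)) ∧
    ∀ d e, ∃ L', HolderSource α T (Ng + duhamelSup δ α M L) L'
      (fun t => pdd (heatSol μ T f g t) d e) := by
  by_cases hT0 : 0 ≤ T
  swap
  · have hno : ∀ t, t ∉ Icc 0 T := fun t ht => hT0 (ht.1.trans ht.2)
    exact ⟨⟨0, fun t ht => (hno t ht).elim, fun t ht => (hno t ht).elim⟩,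
      fun d e => ⟨0, fun t ht => (hno t ht).elim, fun t ht => (hno t ht).elim⟩⟩
  have hM : 0 ≤ M := (hf.space T ⟨hT0, le_rfl⟩).M_nonneg
  have hL : 0 ≤ L := (hf.space T ⟨hT0, le_rfl⟩).nonneg
  have hU := fun t ht => h.heatSol_boundedC2 hα hα1 hδ hT hf hg (t := t) ht
  have hN : 0 ≤ Ng + duhamelSup δ α M L := by
    rw [duhamelSup]; positivity
  constructor
  · refine ⟨_, holderSource_of_chain h hα hT hκ hM (fun t ht => (hU t ht).bh hα.le hα1.le hN)
      (R := fun t t' => duhamel μ f t t') (fun t t' ht htt ht' x => ?_)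
      (fun t t' ht htt ht' => h.heatSol_chain hα hα1 hδ hT hf hg hNg ht htt ht')⟩
    refine ((h.duhamel_bounds hα hα1 hδ hT hf ht htt ht').1 x).trans ?_
    rw [mul_comm]
    refine mul_le_mul_of_nonneg_left ?_ hM
    exact Real.self_le_rpow_of_le_one (sub_nonneg.2 htt) (by linarith) (by linarith)
  · intro d e
    refine ⟨_, holderSource_of_chain h hα hT hκ
      (B := 4 * (δ / 2) ^ (α / 2 - 1) * (2 / α) * L) (by positivity)
      (fun t ht => (hU t ht).pdd_hol d e)
      (R := fun t t' => pdd (duhamel μ f t t') d e) (fun t t' ht htt ht' x => ?_)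
      (fun t t' ht htt ht' => (h.heatSol_chain_pd hα hα1 hδ hT hf hg hNg ht htt ht').2 d e)⟩
    exact ((h.duhamel_bounds hα hα1 hδ hT hf ht htt ht').2.2.2 d e).bd x

lemma HeatFamily.heatSol_pd_holder (h : HeatFamily δ κ α K A μ) (hα : 0 < α) (hα1 : α < 1)
    (hδ : 0 < δ) (hT : T ≤ 1) (hT0 : 0 ≤ T) (hκ : 0 ≤ κ) (hf : HolderSource α T M L f)
    (hg : BoundedC2 α Mg Ng Hg g) (hNg : 0 ≤ Ng) {d : Fin D} {Nd Ld : ℝ}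
    (hgd : BH α Nd Ld (pd g d)) :
    HolderSource α T (Nd + 4 * δ ^ (-1 / 2 : ℝ) * √T * M)
      ((1 + κ) * (Ld + 4 * δ ^ (-1 / 2 : ℝ) * √T * L) +
        2 * δ ^ ((α - 1) / 2) * (2 / (α + 1)) * L * √T)
      (fun t => pd (heatSol μ T f g t) d) := by
  have hM : 0 ≤ M := (hf.space T ⟨hT0, le_rfl⟩).M_nonneg
  have hL : 0 ≤ L := (hf.space T ⟨hT0, le_rfl⟩).nonneg
  refine holderSource_of_chain h hα hT hκ (by positivity) (fun t ht => ?_)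
      (R := fun t t' => pd (duhamel μ f t t') d) (fun t t' ht htt ht' x => ?_)
      (fun t t' ht htt ht' => (h.heatSol_chain_pd hα hα1 hδ hT hf hg hNg ht htt ht').1 d)
  · have := h.prob t T
    have h1 := avg_C2 hα hg (μ t T)
    have e : pd (heatSol μ T f g t) d =
        fun x => avg (μ t T) (pd g d) x + pd (duhamel μ f t T) d x := by
      rw [← h1.2.1 d]
      exact pd_add h1.1.contDiff_one
        (h.duhamel_boundedC2 hα hα1 hδ hT hf ht.1 ht.2 le_rfl).contDiff_one d
    rw [e]
    have h2 : √(T - t) ≤ √T := Real.sqrt_le_sqrt (by linarith [ht.1])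
    exact (hgd.avg hα (μ t T)).add
      (((h.duhamel_bounds hα hα1 hδ hT hf ht.1 ht.2 le_rfl).2.1 d).mono (by gcongr) (by gcongr))
  · refine ((h.duhamel_bounds hα hα1 hδ hT hf ht htt ht').2.2.1 d x).trans ?_
    have h0 := sub_nonneg.2 htt
    rw [mul_assoc _ (√T), add_div, Real.rpow_add' h0 (by positivity), mul_comm (√T),
      Real.sqrt_eq_rpow T]
    gcongr
    linarith

end HeatSolution

section HeatEquation

open MeasureTheory ProbabilityTheory Filter Topology

variable {D : ℕ} {δ δ' κ α K MA : ℝ} {A : ℝ → Matrix (Fin D) (Fin D) ℝ}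
  {μ : ℝ → ℝ → Measure (Fin D → ℝ)} {T M L : ℝ} {f : ℝ → (Fin D → ℝ) → ℝ}
  {Mg Ng Hg : ℝ} {g : (Fin D → ℝ) → ℝ}

/-- Minus the time derivative of a solution of the heat equation. -/
def heatRate (A : ℝ → Matrix (Fin D) (Fin D) ℝ) (f u : ℝ → (Fin D → ℝ) → ℝ) (t : ℝ)
    (x : Fin D → ℝ) : ℝ :=
  1 / 2 * (∑ i, ∑ j, A t i j * pdd (u t) i j x) + f t x

lemma EllipticCoeff.holderSource (hA : EllipticCoeff δ δ' α K MA A) (hα : 0 < α) (hT : T ≤ 1)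
    (i j : Fin D) : HolderSource (D := D) α T |MA| K (fun t _ => A t i j) := by
  have hsub : ∀ t ∈ Icc 0 T, t ∈ Icc (0 : ℝ) 1 := fun t ht => ⟨ht.1, ht.2.trans hT⟩
  refine ⟨fun t ht => ⟨hA.nonneg, fun x => (hA.bd t (hsub t ht) i j).trans (le_abs_self _),
    fun x y => ?_⟩, fun t ht s hs x => ?_⟩
  · rw [sub_self, abs_zero]
    exact mul_nonneg hA.nonneg (Real.rpow_nonneg (en_nonneg _) _)
  · refine (hA.hol t (hsub t ht) s (hsub s hs) i j).trans
      (mul_le_mul_of_nonneg_left ?_ hA.nonneg)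
    refine Real.rpow_le_rpow_of_exponent_ge' (abs_nonneg _) ?_ (by positivity) (by linarith)
    rw [abs_le]
    constructor <;> linarith [ht.1, ht.2, hs.1, hs.2]

lemma EllipticCoeff.heatRate_holder (hA : EllipticCoeff δ δ' α K MA A) (hα : 0 < α) (hT : T ≤ 1)
    (hf : HolderSource α T M L f) {u : ℝ → (Fin D → ℝ) → ℝ}
    (hu : ∀ d e, ∃ M' L', 0 ≤ M' ∧ HolderSource α T M' L' (fun t => pdd (u t) d e)) :
    ∃ M' L', HolderSource α T M' L' (heatRate A f u) := by
  have h1 : ∀ i j, ∃ M' L', 0 ≤ M' ∧ HolderSource α T M' L'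
      (fun t x => A t i j * pdd (u t) i j x) := by
    intro i j
    obtain ⟨M', L', h0, h1⟩ := hu i j
    obtain ⟨L'', h2⟩ := (hA.holderSource hα hT i j).mul h1 (abs_nonneg _) h0
    exact ⟨_, _, mul_nonneg (abs_nonneg _) h0, h2⟩
  obtain ⟨M1, L1, h2, h3⟩ := HolderSource.sum Finset.univ fun i _ =>
    HolderSource.sum Finset.univ fun j _ => h1 i j
  have h4 : HolderSource (D := D) α T (1 / 2) 0 (fun _ _ => 1 / 2) :=
    ⟨fun t _ => ⟨le_rfl, by norm_num, by simp⟩, by simp⟩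
  obtain ⟨L2, h5⟩ := h4.mul h3 (by norm_num) h2
  exact ⟨_, _, h5.add hf⟩

lemma HeatFamily.heatSol_expansion (h : HeatFamily δ κ α K A μ) (hα : 0 < α) (hα1 : α < 1)
    (hδ : 0 < δ) (hT : T ≤ 1) (hκ : 0 ≤ κ) (hK : 0 ≤ K) (hf : HolderSource α T M L f)
    (hg : BoundedC2 α Mg Ng Hg g) (hNg : 0 ≤ Ng) :
    ∃ B, ∀ t ∈ Icc 0 T, ∀ t' ∈ Icc 0 T, t ≤ t' → ∀ x,
      |heatSol μ T f g t x - heatSol μ T f g t' x -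
        (t' - t) * heatRate A f (heatSol μ T f g) t' x| ≤ B * (t' - t) ^ (1 + α / 2) := by
  refine ⟨D ^ 2 * ((Hg + duhamelConst D δ α * L) * κ + K * (Ng + duhamelSup δ α M L)) +
    L * (1 + 2 * κ), fun t ht t' ht' htt x => ?_⟩
  have h1 := h.taylor hα (h.heatSol_boundedC2 hα hα1 hδ hT hf hg ht') hK ht.1 htt
    (ht'.2.trans hT) x
  have h2 := h.duhamel_self_sub hα hT hf ht.1 htt ht'.2 hκ x
  rw [h.heatSol_chain hα hα1 hδ hT hf hg hNg ht.1 htt ht'.2]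
  refine le_trans (le_of_eq ?_) ((abs_add_le _ _).trans ((add_le_add h1 h2).trans
    (le_of_eq (add_mul _ _ _).symm)))
  congr 1
  rw [heatRate]
  ring

lemma HeatFamily.heatSol_hasDerivWithinAt (h : HeatFamily δ κ α K A μ)
    (hA : EllipticCoeff δ δ' α K MA A) (hα : 0 < α) (hα1 : α < 1)
    (hδ : 0 < δ) (hT : T ≤ 1) (hκ : 0 ≤ κ) (hf : HolderSource α T M L f)
    (hg : BoundedC2 α Mg Ng Hg g) (hNg : 0 ≤ Ng) {t : ℝ} (ht : t ∈ Icc 0 T) (x : Fin D → ℝ) :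
    HasDerivWithinAt (fun s => heatSol μ T f g s x)
      (-heatRate A f (heatSol μ T f g) t x) (Icc 0 T) t := by
  obtain ⟨B, hB⟩ := h.heatSol_expansion hα hα1 hδ hT hκ hA.nonneg hf hg hNg
  have hT0 := ht.1.trans ht.2
  have hpd : ∀ d e, ∃ M' L', 0 ≤ M' ∧
      HolderSource α T M' L' (fun t => pdd (heatSol μ T f g t) d e) := fun d e => by
    obtain ⟨L', h1⟩ := (h.heatSol_holder hα hα1 hδ hT hκ hf hg hNg).2 d e
    exact ⟨_, L', (h1.space t ht).M_nonneg, h1⟩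
  obtain ⟨M', L', h1⟩ := hA.heatRate_holder hα hT hf hpd
  refine hasDerivWithinAt_of_expansion (w := fun s => heatRate A f (heatSol μ T f g) s x)
    (B := max B L') (half_pos hα)
    (fun t ht t' ht' htt => (hB t ht t' ht' htt x).trans ?_)
    (fun t ht t' ht' => (h1.time t ht t' ht' x).trans ?_) ht
  · exact mul_le_mul_of_nonneg_right (le_max_left _ _) (Real.rpow_nonneg (sub_nonneg.2 htt) _)
  · exact mul_le_mul_of_nonneg_right (le_max_right _ _) (Real.rpow_nonneg (abs_nonneg _) _)

lemma heatRate_eq {C : ℝ → Matrix (Fin D) (Fin D) ℝ} (f u : ℝ → (Fin D → ℝ) → ℝ) (t : ℝ)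
    (x : Fin D → ℝ) : heatRate (fun t => C t * (C t)ᵀ) f u t x =
      (1 / 2) * (∑ i, ∑ j, pdd (u t) i j x * (C t * (C t)ᵀ) j i) + f t x := by
  have hs : ∀ i j, (C t * (C t)ᵀ) i j = (C t * (C t)ᵀ) j i := fun i j => by
    simp only [Matrix.mul_apply, Matrix.transpose_apply, mul_comm]
  rw [heatRate]
  congr 2
  refine Finset.sum_congr rfl fun i _ => Finset.sum_congr rfl fun j _ => ?_
  rw [mul_comm, hs i j]

lemma HeatFamily.heatSol_isSol {C : ℝ → Matrix (Fin D) (Fin D) ℝ}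
    (h : HeatFamily δ κ α K (fun t => C t * (C t)ᵀ) μ)
    (hA : EllipticCoeff δ δ' α K MA (fun t => C t * (C t)ᵀ)) (hα : 0 < α) (hα1 : α < 1)
    (hδ : 0 < δ) (hT : T ≤ 1) (hT0 : 0 < T) (hκ : 0 ≤ κ) (hf : HolderSource α T M L f)
    (hg : BoundedC2 α Mg Ng Hg g) (hNg : 0 ≤ Ng) : HeatSol T α C f g (heatSol μ T f g) := by
  obtain ⟨⟨L', hu⟩, hudd⟩ := h.heatSol_holder hα hα1 hδ hT hκ hf hg hNg
  have hU := fun t ht => h.heatSol_boundedC2 hα hα1 hδ hT hf hg (t := t) ht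
  have hd := fun t ht => h.heatSol_hasDerivWithinAt hA hα hα1 hδ hT hκ hf hg hNg (t := t) ht
  have hdw : ∀ t ∈ Icc 0 T, (fun x => derivWithin (fun s => heatSol μ T f g s x) (Icc 0 T) t) =
      fun x => -heatRate (fun t => C t * (C t)ᵀ) f (heatSol μ T f g) t x := fun t ht =>
    funext fun x => (hd t ht x).derivWithin (uniqueDiffOn_Icc hT0 t ht)
  have hpd : ∀ d e, ∃ M' L', 0 ≤ M' ∧
      HolderSource α T M' L' (fun t => pdd (heatSol μ T f g t) d e) := fun d e => by
    obtain ⟨L', h1⟩ := hudd d e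
    exact ⟨_, L', (h1.space T ⟨hT0.le, le_rfl⟩).M_nonneg, h1⟩
  obtain ⟨M2, L2, hr⟩ := hA.heatRate_holder hα hT hf hpd
  have hr' := hr.neg.congr hdw
  refine ⟨hu.continuousOn hα, fun t ht => (hU t ht).contDiff,
    fun x t ht => (hd t ht x).differentiableWithinAt, fun t ht x => ?_,
    h.heatSol_final hα hα1 hT hT0.le hg hNg, ⟨_, hu.psup_le⟩, ⟨_, hr'.psup_le⟩,
    ⟨_, hr'.psemi_le hα⟩, fun d => ⟨Ng + duhamelSup δ α M L, ?_⟩, fun d e => ?_, fun d e => ?_⟩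
  · have := congrFun (hdw t ⟨ht.1, ht.2.le⟩) x
    simp only [heatRate_eq] at this
    rw [this]
    ring
  · rintro r ⟨t, x, ht, rfl⟩
    exact (hU t ht).pd_bd d x
  · obtain ⟨M', L', -, h1⟩ := hpd d e
    exact ⟨_, h1.psup_le⟩
  · obtain ⟨M', L', -, h1⟩ := hpd d e
    exact ⟨_, h1.psemi_le hα⟩

end HeatEquation

section Uniqueness

open MeasureTheory ProbabilityTheory Filter Topology

variable {D : ℕ} {δ δ' κ α K MA : ℝ} {C : ℝ → Matrix (Fin D) (Fin D) ℝ}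
  {μ : ℝ → ℝ → Measure (Fin D → ℝ)} {T M L : ℝ} {f : ℝ → (Fin D → ℝ) → ℝ}
  {g : (Fin D → ℝ) → ℝ} {u v : ℝ → (Fin D → ℝ) → ℝ}

lemma HeatSol.boundedC2 (hv : HeatSol T α C f g v) :
    ∃ M N H, ∀ t ∈ Icc 0 T, BoundedC2 α M N H (v t) := by
  obtain ⟨-, hC, -, -, -, h0, -, -, h1, h2, h3⟩ := hv
  choose B1 hB1 using h1
  have hh := fun d e => HolderSource.of_sSup (h2 d e) (h3 d e)
  obtain ⟨B0, hB0⟩ := h0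
  set N1 := ∑ d, |B1 d| with hN1
  set N2 := ∑ d, ∑ e, |sSup (psupSet T fun t => pdd (v t) d e)| with hN2
  set H := ∑ d, ∑ e, |sSup (psemiSet T α fun t => pdd (v t) d e)| with hH
  have hN10 : 0 ≤ N1 := by positivity
  have hN20 : 0 ≤ N2 := by positivity
  have key : ∀ (b : Fin D → Fin D → ℝ) d e, b d e ≤ ∑ d, ∑ e, |b d e| := fun b d e =>
    (le_abs_self _).trans ((Finset.single_le_sum (f := fun e => |b d e|)
      (fun _ _ => abs_nonneg _) (Finset.mem_univ e)).trans
      (Finset.single_le_sum (f := fun d => ∑ e, |b d e|)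
        (fun _ _ => by positivity) (Finset.mem_univ d)))
  refine ⟨B0, N1 + N2, H, fun t ht => ⟨hC t ht, fun x => hB0 ⟨t, x, ht, rfl⟩, fun d x => ?_,
    fun d e => ((hh d e).space t ht).mono ?_
      (key (fun d e => sSup (psemiSet T α fun t => pdd (v t) d e)) d e)⟩⟩
  · have h4 : |pd (v t) d x| ≤ B1 d := hB1 d ⟨t, x, ht, rfl⟩
    have h5 := Finset.single_le_sum (f := fun d => |B1 d|) (fun _ _ => abs_nonneg _)
      (Finset.mem_univ d)
    linarith [le_abs_self (B1 d)]
  · linarith [key (fun d e => sSup (psupSet T fun t => pdd (v t) d e)) d e]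

lemma HeatSol.expansion (hA : EllipticCoeff δ δ' α K MA (fun t => C t * (C t)ᵀ)) (hα : 0 < α)
    (hT : T ≤ 1) (hf : HolderSource α T M L f) (hv : HeatSol T α C f g v) :
    ∃ B, ∀ t ∈ Icc 0 T, ∀ t' ∈ Icc 0 T, t ≤ t' → ∀ x,
      |v t x - v t' x - (t' - t) * heatRate (fun t => C t * (C t)ᵀ) f v t' x| ≤
        B * (t' - t) ^ (1 + α / 2) := by
  obtain ⟨-, -, hd, heq, -, -, -, -, -, h2, h3⟩ := hv
  have hpd : ∀ d e, ∃ M' L', 0 ≤ M' ∧ HolderSource α T M' L' (fun t => pdd (v t) d e) :=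
    fun d e => ⟨_, _, Real.sSup_nonneg (by rintro r ⟨t, x, -, rfl⟩; positivity),
      HolderSource.of_sSup (h2 d e) (h3 d e)⟩
  obtain ⟨M', B, hr⟩ := hA.heatRate_holder hα hT hf hpd
  refine ⟨B, fun t ht t' ht' htt x => ?_⟩
  set q := fun s => heatRate (fun t => C t * (C t)ᵀ) f v s x with hq
  have hB : 0 ≤ B := (hr.space t ht).nonneg
  have h0 := sub_nonneg.2 htt
  have hsub : Icc t t' ⊆ Icc 0 T := Icc_subset_Icc ht.1 ht'.2
  have h4 : ∀ s ∈ Ico t t', HasDerivWithinAt (fun s => v s x + (s - t') * q t')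
      (-q s + 1 * q t') (Ici s) s := by
    intro s hs
    have hsT : s < T := hs.2.trans_le ht'.2
    have hs0 : 0 ≤ s := ht.1.trans hs.1
    have h5 := (hd x s ⟨hs0, hsT.le⟩).hasDerivWithinAt
    have h6 := heq s ⟨hs0, hsT⟩ x
    have h7 : derivWithin (fun s => v s x) (Icc 0 T) s = -q s := by
      rw [hq]; simp only [heatRate_eq]; linarith
    rw [h7] at h5
    have h8 : HasDerivWithinAt (fun s => v s x) (-q s) (Ici s) s := by
      refine h5.mono_of_mem_nhdsWithin ?_
      exact mem_of_superset (Icc_mem_nhdsGE hsT) (Icc_subset_Icc_left hs0)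
    exact h8.add (((hasDerivAt_id s).sub_const t').mul_const (q t')).hasDerivWithinAt
  have h5 : ContinuousOn (fun s => v s x + (s - t') * q t') (Icc t t') := by
    refine ContinuousOn.add (fun s hs => ?_) (by fun_prop)
    exact ((hd x s (hsub hs)).continuousWithinAt).mono hsub
  have h6 := norm_image_sub_le_of_norm_deriv_right_le_segment h5 h4
    (C := B * (t' - t) ^ (α / 2)) (fun s hs => ?_) t' (right_mem_Icc.2 htt)
  · rw [Real.norm_eq_abs, abs_sub_comm] at h6
    rw [Real.rpow_add' h0 (by positivity), Real.rpow_one]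
    refine le_trans (le_of_eq ?_) (h6.trans (le_of_eq (by ring)))
    congr 1
    simp only [hq]
    ring
  · have h7 := hr.time s (hsub ⟨hs.1, hs.2.le⟩) t' ht' x
    rw [Real.norm_eq_abs, one_mul, neg_add_eq_sub, abs_sub_comm]
    refine h7.trans (mul_le_mul_of_nonneg_left ?_ hB)
    refine Real.rpow_le_rpow (abs_nonneg _) ?_ (by positivity)
    rw [abs_sub_comm, abs_of_nonneg (by linarith [hs.2])]
    linarith [hs.1]

lemma HeatSol.mild (h : HeatFamily δ κ α K (fun t => C t * (C t)ᵀ) μ)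
    (hA : EllipticCoeff δ δ' α K MA (fun t => C t * (C t)ᵀ)) (hα : 0 < α)
    (hT : T ≤ 1) (hf : HolderSource α T M L f) (hv : HeatSol T α C f g v) :
    ∃ B, ∀ t ∈ Icc 0 T, ∀ t' ∈ Icc 0 T, t ≤ t' → ∀ x,
      |v t x - (avg (μ t t') (v t') x + (t' - t) * f t' x)| ≤ B * (t' - t) ^ (1 + α / 2) := by
  obtain ⟨M', N', H', h1⟩ := hv.boundedC2
  obtain ⟨B, h2⟩ := hv.expansion hA hα hT hf
  refine ⟨B + D ^ 2 * (H' * κ + K * N'), fun t ht t' ht' htt x => ?_⟩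
  have h3 := h.taylor hα (h1 t' ht') hA.nonneg ht.1 htt (ht'.2.trans hT) x
  refine le_trans (le_of_eq ?_) ((abs_sub _ _).trans ((add_le_add (h2 t ht t' ht' htt x)
    h3).trans (le_of_eq (add_mul _ _ _).symm)))
  congr 1
  rw [heatRate]
  ring

/-- A family of functions which almost contracts along small time steps vanishes. -/
lemma eq_zero_of_almost_contractive {X : Type*} {w : ℝ → X → ℝ} {B β : ℝ} (hβ : 0 < β)
    (hT : ∀ x, w T x = 0)
    (hw : ∀ t ∈ Icc 0 T, ∀ t' ∈ Icc 0 T, t ≤ t' → ∀ S, (∀ x, |w t' x| ≤ S) →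
      ∀ x, |w t x| ≤ S + B * (t' - t) ^ (1 + β)) {t : ℝ} (ht : t ∈ Icc 0 T) (x : X) :
    w t x = 0 := by
  have h0 : 0 ≤ T - t := sub_nonneg.2 ht.2
  have key : ∀ n : ℕ, |w t x| ≤ B * (T - t) ^ (1 + β) * ((n : ℝ) + 1) ^ (-β) := by
    intro n
    have hn : (0 : ℝ) < n + 1 := by positivity
    have hstep : ∀ k : ℕ, k ≤ n + 1 → ∀ x,
        |w (T - k * ((T - t) / (n + 1))) x| ≤ k * (B * ((T - t) / (n + 1)) ^ (1 + β)) := by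
      intro k
      induction k with
      | zero => intro _ x; simp [hT]
      | succ k ih =>
        intro hk x
        have hτ : 0 ≤ (T - t) / (n + 1) := by positivity
        have hmem : ∀ j : ℕ, j ≤ n + 1 → T - j * ((T - t) / (n + 1)) ∈ Icc 0 T := by
          intro j hj
          have hj' : (j : ℝ) ≤ n + 1 := by exact_mod_cast hj
          have h1 : j * ((T - t) / (n + 1)) ≤ T - t := by
            rw [mul_div_assoc', div_le_iff₀ hn, mul_comm]
            exact mul_le_mul_of_nonneg_left hj' h0
          have h2 : 0 ≤ j * ((T - t) / (n + 1)) := by positivity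
          constructor <;> linarith [ht.1]
        have h1 := hw _ (hmem (k + 1) hk) _ (hmem k (by omega))
          (by push_cast; linarith) _ (ih (by omega)) x
        refine h1.trans (le_of_eq ?_)
        have e : T - k * ((T - t) / (n + 1)) - (T - ((k + 1 : ℕ) : ℝ) * ((T - t) / (n + 1))) =
            (T - t) / (n + 1) := by
          push_cast; ring
        rw [e]
        push_cast
        ring
    have h1 := hstep (n + 1) le_rfl x
    push_cast at h1
    rw [mul_div_cancel₀ _ hn.ne', sub_sub_cancel, Real.div_rpow h0 hn.le] at h1
    refine h1.trans (le_of_eq ?_)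
    rw [Real.rpow_neg hn.le, Real.rpow_add hn, Real.rpow_one]
    field_simp
  have hlim : Tendsto (fun n : ℕ => B * (T - t) ^ (1 + β) * ((n : ℝ) + 1) ^ (-β)) atTop
      (𝓝 (B * (T - t) ^ (1 + β) * 0)) :=
    ((tendsto_rpow_neg_atTop hβ).comp
      (tendsto_atTop_add_const_right _ 1 tendsto_natCast_atTop_atTop)).const_mul _
  rw [mul_zero] at hlim
  exact abs_nonpos_iff.1 (ge_of_tendsto' hlim key)

lemma HeatSol.unique (h : HeatFamily δ κ α K (fun t => C t * (C t)ᵀ) μ)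
    (hA : EllipticCoeff δ δ' α K MA (fun t => C t * (C t)ᵀ)) (hα : 0 < α)
    (hT : T ≤ 1) (hf : HolderSource α T M L f) (hv : HeatSol T α C f g v)
    (hu : HeatSol T α C f g u) {t : ℝ} (ht : t ∈ Icc 0 T) (x : Fin D → ℝ) : v t x = u t x := by
  obtain ⟨B, h1⟩ := hv.mild h hA hα hT hf
  obtain ⟨B', h2⟩ := hu.mild h hA hα hT hf
  obtain ⟨M1, N1, H1, h3⟩ := hv.boundedC2
  obtain ⟨M2, N2, H2, h4⟩ := hu.boundedC2
  refine sub_eq_zero.1 (eq_zero_of_almost_contractive (w := fun t x => v t x - u t x)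
    (B := B + B') (half_pos hα) (fun x => ?_) (fun t ht t' ht' htt S hS x => ?_) ht x)
  · rw [hv.2.2.2.2.1, hu.2.2.2.2.1, sub_self]
  · have := h.prob t t'
    have h5 : |avg (μ t t') (v t') x - avg (μ t t') (u t') x| ≤ S :=
      abs_avg_sub_avg_le
        (integrable_translate (h3 t' ht').contDiff.continuous (h3 t' ht').bd x)
        (integrable_translate (h4 t' ht').contDiff.continuous (h4 t' ht').bd x) fun z => hS _
    have h6 := h1 t ht t' ht' htt x
    have h7 := h2 t ht t' ht' htt x
    rw [abs_le] at *
    constructor <;> linarith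

end Uniqueness

section MainTheorem

variable {D : ℕ}

lemma boundedC2_of_sSup {α : ℝ} {g : (Fin D → ℝ) → ℝ} (hg : ContDiff ℝ 2 g)
    (h0 : BddAbove (sup0Set g)) (h1 : ∀ d, BddAbove (sup0Set (pd g d)))
    (h2 : ∀ d e, BddAbove (sup0Set (pdd g d e))) (h3 : ∀ d e, BddAbove (hsemiSet α (pdd g d e))) :
    ∃ N H, 0 ≤ N ∧ BoundedC2 α (sSup (sup0Set g)) N H g := by
  have hb := fun d e => BH.of_sSup (h2 d e) (h3 d e)
  have key : ∀ (b : Fin D → Fin D → ℝ) d e, b d e ≤ ∑ d, ∑ e, |b d e| := fun b d e =>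
    (le_abs_self _).trans ((Finset.single_le_sum (f := fun e => |b d e|)
      (fun _ _ => abs_nonneg _) (Finset.mem_univ e)).trans
      (Finset.single_le_sum (f := fun d => ∑ e, |b d e|)
        (fun _ _ => by positivity) (Finset.mem_univ d)))
  refine ⟨∑ d, |sSup (sup0Set (pd g d))| + ∑ d, ∑ e, |sSup (sup0Set (pdd g d e))|,
    ∑ d, ∑ e, |sSup (hsemiSet α (pdd g d e))|, by positivity, hg, fun x => le_csSup h0 ⟨x, rfl⟩,
    fun d x => ?_, fun d e => (hb d e).mono ?_
      (key (fun d e => sSup (hsemiSet α (pdd g d e))) d e)⟩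
  · have h4 : |pd g d x| ≤ sSup (sup0Set (pd g d)) := le_csSup (h1 d) ⟨x, rfl⟩
    have h5 := Finset.single_le_sum (f := fun d => |sSup (sup0Set (pd g d))|)
      (fun _ _ => abs_nonneg _) (Finset.mem_univ d)
    have h6 : 0 ≤ ∑ d, ∑ e, |sSup (sup0Set (pdd g d e))| := by positivity
    linarith [le_abs_self (sSup (sup0Set (pd g d)))]
  · have h5 : 0 ≤ ∑ d, |sSup (sup0Set (pd g d))| := by positivity
    linarith [key (fun d e => sSup (sup0Set (pdd g d e))) d e]

/-- The first-order parabolic norm of Duhamel's solution. -/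
lemma HeatFamily.unorm1_heatSol_le {δ κ α K T M L N H : ℝ}
    {A : ℝ → Matrix (Fin D) (Fin D) ℝ} {μ : ℝ → ℝ → MeasureTheory.Measure (Fin D → ℝ)}
    {f : ℝ → (Fin D → ℝ) → ℝ} {g : (Fin D → ℝ) → ℝ} (h : HeatFamily δ κ α K A μ) (hα : 0 < α)
    (hα1 : α < 1) (hδ : 0 < δ) (hT : T ≤ 1) (hT0 : 0 ≤ T) (hκ : 0 ≤ κ)
    (hf : HolderSource α T M L f) (hg : BoundedC2 α (sSup (sup0Set g)) N H g) (hN : 0 ≤ N)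
    (h1 : ∀ d, BddAbove (sup0Set (pd g d))) :
    unorm1 T α (heatSol μ T f g) ≤
      (1 + D * (4 * δ ^ (-1 / 2 : ℝ)) + 2 * (1 + κ) + D * (2 * ((1 + κ) *
        (4 * δ ^ (-1 / 2 : ℝ)) + 2 * δ ^ ((α - 1) / 2) * (2 / (α + 1))))) *
      (gnorm1 α g + √T * (M + L)) := by
  set a := 4 * δ ^ (-1 / 2 : ℝ) with ha
  set b := 2 * δ ^ ((α - 1) / 2) * (2 / (α + 1)) with hb
  have ha0 : 0 ≤ a := by positivity
  have hb0 : 0 ≤ b := by positivity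
  have hM : 0 ≤ M := (hf.space T ⟨hT0, le_rfl⟩).M_nonneg
  have hL : 0 ≤ L := (hf.space T ⟨hT0, le_rfl⟩).nonneg
  have hbh : ∀ d, BH α (sSup (sup0Set (pd g d))) (sSup (hsemiSet α (pd g d))) (pd g d) :=
    fun d => BH.of_sSup (h1 d) (hg.pd_bh hα.le hα1.le hN d).bddAbove
  have hp := fun d => h.heatSol_pd_holder hα hα1 hδ hT hT0 hκ hf hg hN (hbh d)
  have hTs : T ≤ √T := Real.le_sqrt_of_sq_le (by nlinarith)
  have e1 : sSup (psupSet T (heatSol μ T f g)) ≤ sSup (sup0Set g) + √T * M := by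
    refine Real.sSup_le ?_ (add_nonneg ((abs_nonneg _).trans (hg.bd 0)) (by positivity))
    rintro r ⟨t, x, ht, rfl⟩
    have := h.prob t T
    refine (abs_add_le _ _).trans (add_le_add (abs_avg_le hg.bd x)
      (((h.duhamel_bounds hα hα1 hδ hT hf ht.1 ht.2 le_rfl).1 x).trans ?_))
    exact mul_le_mul_of_nonneg_right (by linarith [ht.1]) hM
  have e2 : ∑ d, sSup (psupSet T fun t => pd (heatSol μ T f g t) d) ≤
      ∑ d, (sSup (sup0Set (pd g d)) + a * √T * M) := by
    refine Finset.sum_le_sum fun d _ => Real.sSup_le (hp d).psup_le ?_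
    have := (hbh d).M_nonneg
    positivity
  have e3 : ∑ d, sSup (psemiSet T α fun t => pd (heatSol μ T f g t) d) ≤
      ∑ d, (2 * (1 + κ) * sSup (hsemiSet α (pd g d)) + 2 * ((1 + κ) * a + b) * √T * L) := by
    refine Finset.sum_le_sum fun d _ =>
      Real.sSup_le (fun r hr => ((hp d).psemi_le hα r hr).trans (le_of_eq (by ring))) ?_
    have := (hbh d).nonneg
    positivity
  simp only [Finset.sum_add_distrib, ← Finset.mul_sum, Finset.sum_const, Finset.card_univ,
    Fintype.card_fin, nsmul_eq_mul] at e2 e3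
  set S0 := sSup (sup0Set g)
  have hS0 : 0 ≤ S0 := (abs_nonneg _).trans (hg.bd 0)
  have hS1 : 0 ≤ ∑ d, sSup (sup0Set (pd g d)) := Finset.sum_nonneg fun d _ => (hbh d).M_nonneg
  have hS2 : 0 ≤ ∑ d, sSup (hsemiSet α (pd g d)) := Finset.sum_nonneg fun d _ => (hbh d).nonneg
  rw [unorm1, gnorm1]
  set S1 := ∑ d, sSup (sup0Set (pd g d))
  set S2 := ∑ d, sSup (hsemiSet α (pd g d))
  set c := 1 + D * a + 2 * (1 + κ) + D * (2 * ((1 + κ) * a + b)) with hc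
  have hTM : 0 ≤ √T * M := by positivity
  have hTL : 0 ≤ √T * L := by positivity
  have c0 : 0 ≤ D * a := by positivity
  have c1 : 0 ≤ D * (2 * ((1 + κ) * a + b)) := by positivity
  have d0 : S0 ≤ c * S0 := le_mul_of_one_le_left hS0 (by linarith)
  have d1 : S1 ≤ c * S1 := le_mul_of_one_le_left hS1 (by linarith)
  have d2 : 2 * (1 + κ) * S2 ≤ c * S2 := mul_le_mul_of_nonneg_right (by linarith) hS2
  have d3 : (1 + D * a) * (√T * M) ≤ c * (√T * M) :=
    mul_le_mul_of_nonneg_right (by linarith) hTM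
  have d4 : D * (2 * ((1 + κ) * a + b)) * (√T * L) ≤ c * (√T * L) :=
    mul_le_mul_of_nonneg_right (by linarith) hTL
  linarith

end MainTheorem

theorem stmt7 (D : ℕ) (δ δ' α : ℝ) (hδ : 0 < δ) (hδδ : δ ≤ δ')
    (hα : α ∈ Set.Ioo (0:ℝ) 1) :
    ∃ c > 0, ∀ C : ℝ → Matrix (Fin D) (Fin D) ℝ,
      (∃ K, ∀ t ∈ Set.Icc (0:ℝ) 1, ∀ s ∈ Set.Icc (0:ℝ) 1, ∀ i j,
        |C t i j - C s i j| ≤ K * |t - s| ^ α) →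
      Ellip D δ δ' C →
      ∀ T ∈ Set.Ioc (0:ℝ) 1,
      ∀ f : ℝ → (Fin D → ℝ) → ℝ,
        (∃ M, ∀ s ∈ Set.Icc (0:ℝ) T, ∀ x, |f s x| ≤ M) →
        ContinuousOn (fun p : ℝ × (Fin D → ℝ) => f p.1 p.2) (Set.Icc 0 T ×ˢ Set.univ) →
        BddAbove (psemiSet T α f) →
      ∀ g : (Fin D → ℝ) → ℝ, ContDiff ℝ 2 g →
        BddAbove (sup0Set g) →
        (∀ d, BddAbove (sup0Set (pd g d))) →
        (∀ d e, BddAbove (sup0Set (pdd g d e))) →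
        (∀ d e, BddAbove (hsemiSet α (pdd g d e))) →
      ∃ u : ℝ → (Fin D → ℝ) → ℝ,
        HeatSol T α C f g u ∧
        (∀ v, HeatSol T α C f g v → ∀ t ∈ Set.Icc (0:ℝ) T, ∀ x, v t x = u t x) ∧
        unorm1 T α u ≤ c * (gnorm1 α g + Real.sqrt T * fnorm0 T α f) := by
  have hκ := momentConst_nonneg (D := D) (α := α) (hδ.le.trans hδδ)
  refine ⟨1 + D * (4 * δ ^ (-1 / 2 : ℝ)) + 2 * (1 + momentConst D δ' α) + D * (2 *
    ((1 + momentConst D δ' α) * (4 * δ ^ (-1 / 2 : ℝ)) +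
      2 * δ ^ ((α - 1) / 2) * (2 / (α + 1)))), ?_, ?_⟩
  · have := hα.1
    positivity
  rintro C ⟨K, hK⟩ hC T ⟨hT0, hT⟩ f ⟨M, hM⟩ - hfα g hg h0 h1 h2 h3
  obtain ⟨K', MA, hA⟩ := ellipticCoeff_mul_transpose hK hC
  have h := hA.heatFamily hα.1 hδ.le (hδ.le.trans hδδ)
  have hf : HolderSource α T (sSup (psupSet T f)) (sSup (psemiSet T α f)) f := by
    refine HolderSource.of_sSup ⟨M, ?_⟩ hfα
    rintro r ⟨t, x, ht, rfl⟩
    exact hM t ht x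
  obtain ⟨N, H, hN, hg'⟩ := boundedC2_of_sSup hg h0 h1 h2 h3
  have hsol := h.heatSol_isSol hA hα.1 hα.2 hδ hT hT0 hκ hf hg' hN
  exact ⟨_, hsol, fun v hv t ht x => hv.unique h hA hα.1 hT hf hsol ht x,
    h.unorm1_heatSol_le hα.1 hα.2 hδ hT hT0.le hκ hf hg' hN h1⟩
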